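/- Let (b_j, σ_j², ν_j), j = 1,2, be Lévy triplets with σ_j > 0, let t > 0 and ε ∈ (0,1], and let μ_t^j be the probability measure on ℝ with characteristic function u ↦ exp(t(iub_j − u²σ_j²/2 + ∫(e^{iux} − 1 − iux·1_{|x|≤1}) ν_j(dx))). Set b_j(ε) = b_j − ∫_{ε<|x|≤1} x ν_j(dx), σ̄_j²(ε) = ∫_{|x|≤ε} x² ν_j(dx), ν_j^ε = ν_j restricted to ℝ∖(−ε,ε), and λ_j(ε) = ν_j^ε(ℝ), assuming λ_j(ε) > 0. Then ‖μ_t^1 − μ_t^2‖_TV ≤ [√(t/(2π))·|b_1(ε) − b_2(ε)| + √2·|√(σ_1² + σ̄_1²(ε)) − √(σ_2² + σ̄_2²(ε))|] / max(√(σ_1² + σ̄_1²(ε)), √(σ_2² + σ̄_2²(ε))) + Σ_{j=1}^2 √(2/(π t σ_j²))·min(2√(t σ̄_j²(ε)), ε/2) + t·|λ_1(ε) − λ_2(ε)| + t·(λ_1(ε) ∧ λ_2(ε))·‖ν_1^ε/λ_1(ε) − ν_2^ε/λ_2(ε)‖_TV. -/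

import Mathlib

open MeasureTheory ProbabilityTheory
open scoped ENNReal NNReal

/-- Wasserstein "distance" of order `p` with respect to a cost function `c`,
with values in `ℝ≥0∞`: the infimum over all couplings `π` of `μ` and `ν` of
`(∫ c(x,y)^p dπ)^(1/p)`. -/
noncomputable def wassersteinCost {E : Type*} [MeasurableSpace E]
    (c : E → E → ℝ) (p : ℝ) (μ ν : Measure E) : ℝ≥0∞ :=
  ⨅ π ∈ {π : Measure (E × E) |
      IsProbabilityMeasure π ∧ π.map Prod.fst = μ ∧ π.map Prod.snd = ν},
    (∫⁻ z, ENNReal.ofReal (c z.1 z.2) ^ p ∂π) ^ (1 / p)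

/-- Wasserstein distance of order `p` between measures on `ℝ` (usual metric). -/
noncomputable def wasserstein (p : ℝ) (μ ν : Measure ℝ) : ℝ≥0∞ :=
  wassersteinCost (fun x y => |x - y|) p μ ν

/-- Characteristic function of a measure on `ℝ`. -/
noncomputable def charFn (μ : Measure ℝ) (u : ℝ) : ℂ :=
  ∫ x, Complex.exp ((u * x : ℝ) * Complex.I) ∂μ

/-- Toscani–Fourier distance of order `s`, with values in `ℝ≥0∞`. -/
noncomputable def toscani (s : ℝ) (μ ν : Measure ℝ) : ℝ≥0∞ :=
  ⨆ u : {u : ℝ // u ≠ 0}, ENNReal.ofReal (‖charFn μ u.1 - charFn ν u.1‖ / |u.1| ^ s)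

/-- Total variation distance between two measures. -/
noncomputable def tvDist {α : Type*} [MeasurableSpace α] (μ ν : Measure α) : ℝ :=
  ⨆ A : {A : Set α // MeasurableSet A}, |(μ A.1).toReal - (ν A.1).toReal|

/-- Convolution of two measures on `ℝ`. -/
noncomputable def mconv (μ ν : Measure ℝ) : Measure ℝ :=
  (μ.prod ν).map (fun z => z.1 + z.2)

/-- The Poisson distribution with mean `lam`, as a measure on `ℕ`. -/
noncomputable def poissonNat (lam : ℝ) : Measure ℕ :=
  Measure.sum fun k : ℕ =>
    ENNReal.ofReal (Real.exp (-lam) * lam ^ k / (Nat.factorial k)) • Measure.dirac k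

/-- The Poisson distribution with mean `lam`, as a measure on `ℝ`. -/
noncomputable def poissonReal (lam : ℝ) : Measure ℝ :=
  Measure.sum fun k : ℕ =>
    ENNReal.ofReal (Real.exp (-lam) * lam ^ k / (Nat.factorial k)) • Measure.dirac (k : ℝ)

/-- `f'` is a weak derivative of `f` on `ℝ`. -/
def IsWeakDeriv (f f' : ℝ → ℝ) : Prop :=
  ∀ φ : ℝ → ℝ, ContDiff ℝ (⊤ : ℕ∞) φ → HasCompactSupport φ →
    ∫ x, f x * deriv φ x = -∫ x, f' x * φ x

/-- The integrand of the Lévy–Khintchine exponent with truncation `1`. -/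
noncomputable def lkIntegrand (u x : ℝ) : ℂ :=
  Complex.exp ((u * x : ℝ) * Complex.I) - 1 -
    (if |x| ≤ 1 then ((u * x : ℝ) : ℂ) * Complex.I else 0)

/-- The integrand of the Lévy–Khintchine exponent fully compensated (for small jumps). -/
noncomputable def lkIntegrandC (u x : ℝ) : ℂ :=
  Complex.exp ((u * x : ℝ) * Complex.I) - 1 - ((u * x : ℝ) : ℂ) * Complex.I

section PartOne

open MeasureTheory ProbabilityTheory
open scoped ENNReal NNReal

lemma growth_le {f f' : ℝ → ℝ} {C : ℝ} (n : ℕ) (hf : ∀ x, HasDerivAt f (f' x) x) (h0 : f 0 = 0)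
    (hb : ∀ x, |f' x| ≤ C * |x| ^ n) (x : ℝ) : |f x| ≤ C * |x| ^ (n + 1) / (n + 1) := by
  have key : ∀ g g' : ℝ → ℝ, (∀ x, HasDerivAt g (g' x) x) → g 0 = 0 →
      (∀ x, |g' x| ≤ C * |x| ^ n) → ∀ x, 0 ≤ x → |g x| ≤ C * x ^ (n + 1) / (n + 1) := by
    intro g g' hg hg0 hgb x hx
    have := image_norm_le_of_norm_deriv_right_le_deriv_boundary (f := g) (f' := g') (a := 0) (b := x)
      (B := fun y => C * y ^ (n + 1) / (n + 1)) (B' := fun y => C * y ^ n)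
      (fun y _ => (hg y).continuousAt.continuousWithinAt) (fun y _ => (hg y).hasDerivWithinAt)
      (by simp [hg0]) (fun y => by
        have := (((hasDerivAt_pow (n + 1) y).const_mul C).div_const ((n : ℝ) + 1))
        have hn : (n : ℝ) + 1 ≠ 0 := by positivity
        refine this.congr_deriv ?_
        rw [Nat.add_sub_cancel]
        push_cast
        field_simp)
      (fun y hy => by
        have := hgb y
        rwa [abs_of_nonneg hy.1] at this)
      (x := x) ⟨hx, le_refl _⟩
    simpa using this
  rcases le_total 0 x with hx | hx
  · rw [abs_of_nonneg hx]; exact key f f' hf h0 hb x hx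
  · have := key (fun y => f (-y)) (fun y => - f' (-y)) (fun y => by
      simpa [Function.comp_def] using (hf (-y)).scomp y (hasDerivAt_neg y)) (by simpa using h0)
      (fun y => by simpa using hb (-y)) (-x) (by linarith)
    rw [abs_of_nonpos hx]; simpa using this

lemma taylor2 {G0 G1 G2 : ℝ → ℝ} {D : ℝ} (h0 : ∀ x, HasDerivAt G0 (G1 x) x)
    (h1 : ∀ x, HasDerivAt G1 (G2 x) x) (hD : ∀ x, |G2 x| ≤ D) (x : ℝ) :
    |G0 x - G0 0 - G1 0 * x| ≤ D * x ^ 2 / 2 := by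
  have a1 : ∀ x, |G1 x - G1 0| ≤ D * |x| ^ 1 := fun x => by
    have := growth_le (f := fun x => G1 x - G1 0) (f' := G2) (C := D) 0
      (fun x => (h1 x).sub_const _) (by simp) (by simpa using hD) x
    simpa using this
  have := growth_le (f := fun x => G0 x - G0 0 - G1 0 * x) (f' := fun x => G1 x - G1 0) (C := D) 1
      (fun x => by
        have := ((h0 x).sub_const (G0 0)).sub ((hasDerivAt_id x).const_mul (G1 0))
        rw [mul_one] at this
        exact this) (by simp) a1 x
  refine this.trans (le_of_eq ?_)
  simp [sq_abs]; norm_num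

lemma taylor3 {G0 G1 G2 G3 : ℝ → ℝ} {D : ℝ} (h0 : ∀ x, HasDerivAt G0 (G1 x) x)
    (h1 : ∀ x, HasDerivAt G1 (G2 x) x) (h2 : ∀ x, HasDerivAt G2 (G3 x) x)
    (hD : ∀ x, |G3 x| ≤ D) (x : ℝ) :
    |G0 x - G0 0 - G1 0 * x - G2 0 * x ^ 2 / 2| ≤ D * |x| ^ 3 / 6 := by
  have a1 : ∀ x, |G1 x - G1 0 - G2 0 * x| ≤ D / 2 * |x| ^ 2 := fun x => by
    have := taylor2 h1 h2 hD x
    rw [sq_abs]; linarith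
  have := growth_le (f := fun x => G0 x - G0 0 - G1 0 * x - G2 0 * x ^ 2 / 2)
      (f' := fun x => G1 x - G1 0 - G2 0 * x) (C := D / 2) 2
      (fun x => by
        have := (((h0 x).sub_const (G0 0)).sub ((hasDerivAt_id x).const_mul (G1 0))).sub
          (((hasDerivAt_pow 2 x).const_mul (G2 0)).div_const 2)
        refine HasDerivAt.congr_deriv this ?_
        push_cast; ring) (by simp) a1 x
  refine this.trans (le_of_eq ?_)
  push_cast; ring

lemma gdiff {P Q H : ℝ → ℝ} {C : ℝ}
    (hPQ : ∀ z, HasDerivAt (fun z => P z * Real.exp (-z ^ 2 / 2)) (-(Q z * Real.exp (-z ^ 2 / 2))) z)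
    (hPc : Continuous P) (hQc : Continuous Q)
    (hP : ∀ z, |P z| ≤ C * Real.exp (z ^ 2 / 4)) (hQ : ∀ z, |Q z| ≤ C * Real.exp (z ^ 2 / 4))
    (hH : Measurable H) (hH1 : ∀ w, |H w| ≤ 1 / 2) (x : ℝ) :
    HasDerivAt (fun x => ∫ w, H w * (P (w - x) * Real.exp (-(w - x) ^ 2 / 2)))
      (∫ w, H w * (Q (w - x) * Real.exp (-(w - x) ^ 2 / 2))) x := by
  have hC : 0 ≤ C := by
    have := (abs_nonneg _).trans (hP 0)
    simpa using this
  have bd : ∀ (R : ℝ → ℝ), (∀ z, |R z| ≤ C * Real.exp (z ^ 2 / 4)) → ∀ w y, |y - x| < 1 →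
      ‖H w * (R (w - y) * Real.exp (-(w - y) ^ 2 / 2))‖ ≤
        C * Real.exp (1 / 4) * Real.exp (-(1 / 8) * (w - x) ^ 2) := by
    intro R hR w y hy
    rw [norm_mul, norm_mul]
    simp only [Real.norm_eq_abs, Real.abs_exp]
    have h1 : |R (w - y)| * Real.exp (-(w - y) ^ 2 / 2) ≤
        C * Real.exp (1 / 4) * Real.exp (-(1 / 8) * (w - x) ^ 2) := by
      calc |R (w - y)| * Real.exp (-(w - y) ^ 2 / 2)
          ≤ C * Real.exp ((w - y) ^ 2 / 4) * Real.exp (-(w - y) ^ 2 / 2) := by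
            gcongr; exact hR _
        _ = C * Real.exp (-(w - y) ^ 2 / 4) := by
            rw [mul_assoc, ← Real.exp_add]; ring_nf
        _ ≤ C * Real.exp (1 / 4 + -(1 / 8) * (w - x) ^ 2) := by
            gcongr
            have : (y - x) ^ 2 ≤ 1 := by
              rw [← sq_abs]; nlinarith [abs_nonneg (y - x)]
            nlinarith [sq_nonneg ((w - y) - (y - x))]
        _ = _ := by rw [Real.exp_add]; ring
    calc |H w| * (|R (w - y)| * Real.exp (-(w - y) ^ 2 / 2))
        ≤ 1 * (|R (w - y)| * Real.exp (-(w - y) ^ 2 / 2)) := by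
          gcongr; linarith [hH1 w]
      _ ≤ _ := by rw [one_mul]; exact h1
  have hIntg : Integrable (fun w => C * Real.exp (1 / 4) * Real.exp (-(1 / 8) * (w - x) ^ 2)) volume :=
    ((integrable_exp_neg_mul_sq (b := 1 / 8) (by norm_num)).comp_sub_right x).const_mul _
  have meas : ∀ (R : ℝ → ℝ), Continuous R → ∀ y,
      AEStronglyMeasurable (fun w => H w * (R (w - y) * Real.exp (-(w - y) ^ 2 / 2))) volume := by
    intro R hR y
    refine (hH.mul ?_).aestronglyMeasurable
    exact Continuous.measurable (by fun_prop)
  refine (hasDerivAt_integral_of_dominated_loc_of_deriv_le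
    (F := fun x w => H w * (P (w - x) * Real.exp (-(w - x) ^ 2 / 2)))
    (F' := fun x w => H w * (Q (w - x) * Real.exp (-(w - x) ^ 2 / 2)))
    (s := Metric.ball x 1) (bound := fun w => C * Real.exp (1 / 4) * Real.exp (-(1 / 8) * (w - x) ^ 2))
    (Metric.ball_mem_nhds x one_pos) (Filter.Eventually.of_forall fun y => meas P hPc y)
    ?_ (meas Q hQc x) ?_ hIntg ?_).2
  · exact hIntg.mono' (meas P hPc x) (Filter.Eventually.of_forall fun w => bd P hP w x (by simp))
  · exact Filter.Eventually.of_forall fun w y hy => bd Q hQ w y (by simpa [Real.dist_eq] using hy)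
  · refine Filter.Eventually.of_forall fun w y hy => ?_
    have := ((hPQ (w - y)).scomp y ((hasDerivAt_id y).const_sub w)).const_mul (H w)
    simpa [Function.comp_def] using this

end PartOne

section PartTwo

open MeasureTheory ProbabilityTheory
open scoped ENNReal NNReal

lemma poly_bd0 (z : ℝ) : z ^ 3 - 3 * z ≤ 1.3 + 1.45 * z ^ 2 - 0.6 * z ^ 4 + 0.09 * z ^ 6 := by
  nlinarith [sq_nonneg (-25/9 + (-38/9) * z + z ^ 3), sq_nonneg (-59/32 + (-25/16) * z + z ^ 2),
    sq_nonneg (-475/1294 + z)]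

lemma poly_bd (z : ℝ) : |z ^ 3 - 3 * z| ≤ 1.3 + 1.45 * z ^ 2 - 0.6 * z ^ 4 + 0.09 * z ^ 6 := by
  have h1 := poly_bd0 z
  have h2 := poly_bd0 (-z)
  rw [abs_le]
  constructor
  · have : (-z) ^ 3 - 3 * (-z) = - (z ^ 3 - 3 * z) := by ring
    rw [this] at h2
    have e : 1.3 + 1.45 * (-z) ^ 2 - 0.6 * (-z) ^ 4 + 0.09 * (-z) ^ 6
      = 1.3 + 1.45 * z ^ 2 - 0.6 * z ^ 4 + 0.09 * z ^ 6 := by ring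
    linarith
  · exact h1

lemma integrable_pow_gauss (n : ℕ) : Integrable (fun z : ℝ => z ^ n) (gaussianReal 0 1) := by
  have h : MemLp id (n : ℝ≥0∞) (gaussianReal 0 1) := by
    have := memLp_id_gaussianReal (μ := 0) (v := 1) (n : ℝ≥0)
    simpa using this
  have := h.integrable_norm_pow'
  refine this.mono (by fun_prop) ?_
  filter_upwards with z
  simp

lemma pdf_std (z : ℝ) : gaussianPDFReal 0 1 z = (√(2 * Real.pi))⁻¹ * Real.exp (-z ^ 2 / 2) := by
  simp [gaussianPDFReal]

lemma integral_std (f : ℝ → ℝ) : ∫ z, f z ∂(gaussianReal 0 1) =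
    (√(2 * Real.pi))⁻¹ * ∫ z, f z * Real.exp (-z ^ 2 / 2) := by
  rw [integral_gaussianReal_eq_integral_smul one_ne_zero, ← integral_const_mul]
  congr 1; ext z; rw [pdf_std, smul_eq_mul]; ring

lemma integrable_std_iff (f : ℝ → ℝ) : Integrable f (gaussianReal 0 1) ↔
    Integrable (fun z => f z * Real.exp (-z ^ 2 / 2)) := by
  rw [gaussianReal_of_var_ne_zero _ one_ne_zero, integrable_withDensity_iff_integrable_smul'
    (measurable_gaussianPDF _ _) (ae_of_all _ fun _ ↦ gaussianPDF_lt_top)]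
  have : (fun x => (gaussianPDF 0 1 x).toReal • f x) =
     fun x => (√(2 * Real.pi))⁻¹ * (f x * Real.exp (-x ^ 2 / 2)) := by
    ext x; rw [toReal_gaussianPDF, pdf_std, smul_eq_mul]; ring
  rw [this]
  exact integrable_const_mul_iff (by
    have : (√(2 * Real.pi))⁻¹ ≠ 0 := by positivity
    exact this.isUnit) _

lemma hasDerivAt_expsq (z : ℝ) : HasDerivAt (fun z : ℝ => Real.exp (-z ^ 2 / 2))
    (- z * Real.exp (-z ^ 2 / 2)) z := by
  have h : HasDerivAt (fun z : ℝ => -z ^ 2 / 2) (-z) z := by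
    have := ((hasDerivAt_pow 2 z).neg).div_const 2
    refine HasDerivAt.congr_deriv this ?_
    push_cast; ring
  exact h.exp.congr_deriv (by ring)

lemma gauss_moment_rec (n : ℕ) : ∫ z, z ^ (n + 2) ∂(gaussianReal 0 1) =
    (n + 1) * ∫ z, z ^ n ∂(gaussianReal 0 1) := by
  rw [integral_std, integral_std]
  have i1 := (integrable_std_iff _).1 (integrable_pow_gauss (n + 2))
  have i0 := (integrable_std_iff _).1 (integrable_pow_gauss n)
  have i2 := (integrable_std_iff _).1 (integrable_pow_gauss (n + 1))
  have := integral_eq_zero_of_hasDerivAt_of_integrable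
    (f := fun z : ℝ => z ^ (n + 1) * Real.exp (-z ^ 2 / 2))
    (f' := fun z : ℝ => (n + 1) * (z ^ n * Real.exp (-z ^ 2 / 2)) - z ^ (n + 2) * Real.exp (-z ^ 2 / 2))
    (fun z => by
      refine ((hasDerivAt_pow (n + 1) z).mul (hasDerivAt_expsq z)).congr_deriv ?_
      rw [Nat.add_sub_cancel]; push_cast; ring)
    ((i0.const_mul _).sub i1) i2
  rw [integral_sub (i0.const_mul _) i1, integral_const_mul] at this
  rw [show ∫ z : ℝ, z ^ (n + 2) * Real.exp (-z ^ 2 / 2) = (n + 1) * ∫ z : ℝ, z ^ n * Real.exp (-z ^ 2 / 2) by linarith]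
  ring

lemma gauss_m2 : ∫ z, z ^ 2 ∂(gaussianReal 0 1) = 1 := by
  have := gauss_moment_rec 0
  simpa using this
lemma gauss_m4 : ∫ z, z ^ 4 ∂(gaussianReal 0 1) = 3 := by
  have := gauss_moment_rec 2
  rw [gauss_m2] at this
  norm_num at this; exact this
lemma gauss_m6 : ∫ z, z ^ 6 ∂(gaussianReal 0 1) = 15 := by
  have := gauss_moment_rec 4
  rw [gauss_m4] at this
  norm_num at this; exact this

lemma abs_he3 : ∫ z, |z ^ 3 - 3 * z| ∂(gaussianReal 0 1) ≤ 2.3 := by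
  have i0 : Integrable (fun _ : ℝ => (1.3 : ℝ)) (gaussianReal 0 1) := integrable_const _
  have i2 := (integrable_pow_gauss 2).const_mul 1.45
  have i4 := (integrable_pow_gauss 4).const_mul 0.6
  have i6 := (integrable_pow_gauss 6).const_mul 0.09
  calc _ ≤ ∫ z, (1.3 + 1.45 * z ^ 2 - 0.6 * z ^ 4 + 0.09 * z ^ 6) ∂(gaussianReal 0 1) := by
        refine integral_mono_of_nonneg (ae_of_all _ fun z => abs_nonneg _)
          (((i0.add i2).sub i4).add i6) (ae_of_all _ poly_bd)
    _ = 2.3 := by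
        rw [integral_add (f := fun z : ℝ => 1.3 + 1.45 * z ^ 2 - 0.6 * z ^ 4) ((i0.add i2).sub i4) i6,
          integral_sub (f := fun z : ℝ => 1.3 + 1.45 * z ^ 2) (i0.add i2) i4, integral_add i0 i2,
          integral_const_mul, integral_const_mul, integral_const_mul, gauss_m2, gauss_m4, gauss_m6]
        simp; norm_num

lemma abs_he2 : ∫ z, |z ^ 2 - 1| ∂(gaussianReal 0 1) ≤ 2 := by
  have i0 : Integrable (fun _ : ℝ => (1 : ℝ)) (gaussianReal 0 1) := integrable_const _
  have i2 := (integrable_pow_gauss 2)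
  calc _ ≤ ∫ z, (z ^ 2 + 1) ∂(gaussianReal 0 1) := by
        refine integral_mono_of_nonneg (ae_of_all _ fun z => abs_nonneg _)
          (i2.add i0) (ae_of_all _ fun z => ?_)
        show |z ^ 2 - 1| ≤ z ^ 2 + 1
        rw [abs_le]; constructor <;> nlinarith [sq_nonneg z]
    _ = 2 := by
        rw [integral_add i2 i0, gauss_m2]
        simp; norm_num

lemma abs_m3 : ∫ z, |z| ^ 3 ∂(gaussianReal 0 1) ≤ 2 := by
  have i4 := (integrable_pow_gauss 4)
  have i2 := (integrable_pow_gauss 2)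
  calc _ ≤ ∫ z, (z ^ 2 + z ^ 4) / 2 ∂(gaussianReal 0 1) := by
        refine integral_mono_of_nonneg (ae_of_all _ fun z => by positivity)
          ((i2.add i4).div_const 2) (ae_of_all _ fun z => ?_)
        show |z| ^ 3 ≤ (z ^ 2 + z ^ 4) / 2
        have h2 : z ^ 2 = |z| ^ 2 := (sq_abs z).symm
        have h4 : z ^ 4 = |z| ^ 4 := by rw [show z ^ 4 = (z ^ 2) ^ 2 by ring, h2]; ring
        rw [h2, h4]
        nlinarith [sq_nonneg (|z| * (|z| - 1))]
    _ = 2 := by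
        rw [integral_div, integral_add i2 i4, gauss_m2, gauss_m4]
        norm_num

lemma exp_dom (z : ℝ) : 1 + z ^ 2 / 4 + z ^ 4 / 32 ≤ Real.exp (z ^ 2 / 4) := by
  have := Real.quadratic_le_exp_of_nonneg (x := z ^ 2 / 4) (by positivity)
  linarith

/-- Taylor estimates for the Gaussian smoothing of a bounded function. -/
lemma gauss_taylor {H : ℝ → ℝ} (hH : Measurable H) (hH1 : ∀ w, |H w| ≤ 1 / 2) :
    ∃ A B : ℝ, (∀ x, |(∫ z, H (z + x) ∂(gaussianReal 0 1)) - (∫ z, H z ∂(gaussianReal 0 1)) - A * x|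
        ≤ x ^ 2 / 2) ∧
      (∀ x, |(∫ z, H (z + x) ∂(gaussianReal 0 1)) - (∫ z, H z ∂(gaussianReal 0 1)) - A * x
        - B * x ^ 2 / 2| ≤ 1.15 * |x| ^ 3 / 6) := by
  set K : ℝ := (√(2 * Real.pi))⁻¹ with hK
  have hKpos : 0 < K := by positivity
  let G : (ℝ → ℝ) → ℝ → ℝ := fun P x => K * ∫ w, H w * (P (w - x) * Real.exp (-(w - x) ^ 2 / 2))
  have hG0 : ∀ x, ∫ z, H (z + x) ∂(gaussianReal 0 1) = G (fun _ => 1) x := by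
    intro x
    rw [integral_std]
    show K * _ = K * _
    congr 1
    rw [← integral_sub_right_eq_self _ x]
    simp
  have hder : ∀ (P Q : ℝ → ℝ), (∀ z, HasDerivAt P (z * P z - Q z) z) → Continuous P → Continuous Q →
      (∀ z, |P z| ≤ 64 * Real.exp (z ^ 2 / 4)) → (∀ z, |Q z| ≤ 64 * Real.exp (z ^ 2 / 4)) →
      ∀ x, HasDerivAt (G P) (G Q x) x := by
    intro P Q hPQ hPc hQc hP hQ x
    refine (gdiff (fun z => ?_) hPc hQc hP hQ hH hH1 x).const_mul K
    refine ((hPQ z).mul (hasDerivAt_expsq z)).congr_deriv ?_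
    ring
  have hbd : ∀ (P : ℝ → ℝ), Continuous P → Integrable P (gaussianReal 0 1) →
      ∀ x, |G P x| ≤ (∫ z, |P z| ∂(gaussianReal 0 1)) / 2 := by
    intro P hPc hPi x
    rw [integral_std]
    show |K * _| ≤ _
    rw [abs_mul, abs_of_pos hKpos, ← hK, mul_div_assoc]
    gcongr
    rw [← integral_div, ← Real.norm_eq_abs, ← integral_sub_right_eq_self (μ := volume) (fun a => |P a| * Real.exp (-a ^ 2 / 2) / 2) x]
    refine norm_integral_le_of_norm_le ?_ (ae_of_all _ fun w => ?_)
    · have := ((integrable_std_iff _).1 hPi.abs).div_const 2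
      exact this.comp_sub_right x
    · rw [norm_mul, norm_mul]
      simp only [Real.norm_eq_abs, Real.abs_exp]
      have := hH1 w
      have h0 : 0 ≤ |P (w - x)| * Real.exp (-(w - x) ^ 2 / 2) := by positivity
      nlinarith
  have hz1 : ∀ z : ℝ, |z| ≤ (1 + z ^ 2) / 2 := fun z => by
    rw [← sq_abs]; nlinarith [sq_nonneg (|z| - 1)]
  have hz3 : ∀ z : ℝ, |z| ^ 3 ≤ (z ^ 2 + z ^ 4) / 2 := fun z => by
    have h2 : z ^ 2 = |z| ^ 2 := (sq_abs z).symm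
    have h4 : z ^ 4 = |z| ^ 4 := by rw [show z ^ 4 = (z ^ 2) ^ 2 by ring, h2]; ring
    rw [h2, h4]
    nlinarith [sq_nonneg (|z| * (|z| - 1))]
  have b0 : ∀ z : ℝ, |(fun _ : ℝ => (1 : ℝ)) z| ≤ 64 * Real.exp (z ^ 2 / 4) := fun z => by
    have := exp_dom z
    simp only [abs_one]
    nlinarith [sq_nonneg z, sq_nonneg (z ^ 2)]
  have b1 : ∀ z : ℝ, |z| ≤ 64 * Real.exp (z ^ 2 / 4) := fun z => by
    have := exp_dom z
    nlinarith [sq_nonneg z, sq_nonneg (z ^ 2), hz1 z]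
  have b2 : ∀ z : ℝ, |z ^ 2 - 1| ≤ 64 * Real.exp (z ^ 2 / 4) := fun z => by
    have := exp_dom z
    have h : |z ^ 2 - 1| ≤ z ^ 2 + 1 := by
      rw [abs_le]; constructor <;> nlinarith [sq_nonneg z]
    nlinarith [sq_nonneg z, sq_nonneg (z ^ 2)]
  have b3 : ∀ z : ℝ, |z ^ 3 - 3 * z| ≤ 64 * Real.exp (z ^ 2 / 4) := fun z => by
    have := exp_dom z
    have h : |z ^ 3 - 3 * z| ≤ |z| ^ 3 + 3 * |z| := by
      refine (abs_sub _ _).trans ?_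
      rw [abs_pow, abs_mul]; norm_num
    nlinarith [sq_nonneg z, sq_nonneg (z ^ 2), hz1 z, hz3 z]
  have d0 := hder (fun _ => 1) (fun z => z) (fun z => (hasDerivAt_const z (1 : ℝ)).congr_deriv (by ring))
    (by fun_prop) (by fun_prop) b0 b1
  have d1 := hder (fun z => z) (fun z => z ^ 2 - 1)
    (fun z => (hasDerivAt_id z).congr_deriv (by ring)) (by fun_prop) (by fun_prop) b1 b2
  have d2 := hder (fun z => z ^ 2 - 1) (fun z => z ^ 3 - 3 * z)
    (fun z => ((hasDerivAt_pow 2 z).sub_const 1).congr_deriv (by push_cast; ring))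
    (by fun_prop) (by fun_prop) b2 b3
  have c2 : ∀ x, |G (fun z => z ^ 2 - 1) x| ≤ 1 := fun x =>
    (hbd (fun z => z ^ 2 - 1) (by fun_prop) ((integrable_pow_gauss 2).sub (integrable_const 1)) x).trans
      (by linarith [abs_he2])
  have c3 : ∀ x, |G (fun z => z ^ 3 - 3 * z) x| ≤ 1.15 := fun x =>
    (hbd (fun z => z ^ 3 - 3 * z) (by fun_prop) ((integrable_pow_gauss 3).sub
      (by simpa using (integrable_pow_gauss 1).const_mul 3)) x).trans
      (by linarith [abs_he3])
  refine ⟨G (fun z => z) 0, G (fun z => z ^ 2 - 1) 0, fun x => ?_, fun x => ?_⟩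
  · have := taylor2 d0 d1 c2 x
    rw [← hG0, ← hG0] at this
    simpa using this
  · have := taylor3 d0 d1 d2 c3 x
    rw [← hG0, ← hG0] at this
    simpa using this

end PartTwo

section PartThree

open MeasureTheory ProbabilityTheory
open scoped ENNReal NNReal

/-- One-sided total variation bound against measurable functions with values in `[0,1]`. -/
def TVle (μ ν : Measure ℝ) (R : ℝ) : Prop :=
  ∀ h : ℝ → ℝ, Measurable h → (∀ x, 0 ≤ h x) → (∀ x, h x ≤ 1) →
    ∫ x, h x ∂μ - ∫ x, h x ∂ν ≤ R

lemma integrable_unit {μ : Measure ℝ} [IsFiniteMeasure μ] {h : ℝ → ℝ} (hm : Measurable h)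
    (h0 : ∀ x, 0 ≤ h x) (h1 : ∀ x, h x ≤ 1) : Integrable h μ :=
  (integrable_const (1 : ℝ)).mono' hm.aestronglyMeasurable
    (ae_of_all _ fun x => by rw [Real.norm_eq_abs, abs_of_nonneg (h0 x)]; exact h1 x)

lemma TVle.mono {μ ν : Measure ℝ} {R R' : ℝ} (h : TVle μ ν R) (hR : R ≤ R') : TVle μ ν R' :=
  fun f a b c => (h f a b c).trans hR

lemma TVle.trans {μ ν ρ : Measure ℝ} {R R' : ℝ} (h : TVle μ ν R) (h' : TVle ν ρ R') :
    TVle μ ρ (R + R') := fun f a b c => by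
  have := h f a b c
  have := h' f a b c
  linarith

lemma TVle.symm {μ ν : Measure ℝ} [IsProbabilityMeasure μ] [IsProbabilityMeasure ν] {R : ℝ}
    (h : TVle μ ν R) : TVle ν μ R := fun f a b c => by
  have := h (fun x => 1 - f x) (by fun_prop) (fun x => by linarith [c x]) (fun x => by linarith [b x])
  rw [integral_sub (integrable_const _) (integrable_unit a b c),
    integral_sub (integrable_const _) (integrable_unit a b c)] at this
  simp at this
  linarith

lemma TVle.one {μ ν : Measure ℝ} [IsProbabilityMeasure μ] [IsProbabilityMeasure ν] :
    TVle μ ν 1 := fun f a b c => by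
  have h1 : ∫ x, f x ∂μ ≤ ∫ _, (1 : ℝ) ∂μ := integral_mono (integrable_unit a b c) (integrable_const _) c
  have h2 : 0 ≤ ∫ x, f x ∂ν := integral_nonneg b
  simp at h1
  linarith

lemma TVle.conv_right {μ ν κ : Measure ℝ} [IsProbabilityMeasure μ] [IsProbabilityMeasure ν]
    [IsProbabilityMeasure κ] {R : ℝ} (h : TVle μ ν R) : TVle (μ ∗ κ) (ν ∗ κ) R := fun f a b c => by
  rw [Measure.conv_comm μ κ, Measure.conv_comm ν κ, integral_conv (integrable_unit a b c),
    integral_conv (integrable_unit a b c)]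
  have m : ∀ (ρ : Measure ℝ) [IsProbabilityMeasure ρ], Integrable (fun x => ∫ y, f (x + y) ∂ρ) κ := by
    intro ρ _
    refine integrable_unit ?_ (fun x => integral_nonneg fun y => b _) (fun x => ?_)
    · refine (StronglyMeasurable.integral_prod_right (f := fun x y => f (x + y)) ?_).measurable
      exact (a.comp (measurable_fst.add measurable_snd)).stronglyMeasurable
    · have : ∫ y, f (x + y) ∂ρ ≤ ∫ _, (1 : ℝ) ∂ρ :=
        integral_mono (integrable_unit (by fun_prop) (fun _ => b _) (fun _ => c _)) (integrable_const _)
          (fun _ => c _)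
      simpa using this
  rw [← integral_sub (m μ) (m ν)]
  calc _ ≤ ∫ _, R ∂κ := integral_mono ((m μ).sub (m ν)) (integrable_const _) (fun x =>
        h (fun y => f (x + y)) (by fun_prop) (fun _ => b _) (fun _ => c _))
    _ = R := by simp

lemma TVle.conv {μ ν κ ρ : Measure ℝ} [IsProbabilityMeasure μ] [IsProbabilityMeasure ν]
    [IsProbabilityMeasure κ] [IsProbabilityMeasure ρ] {R R' : ℝ} (h : TVle μ ν R) (h' : TVle κ ρ R') :
    TVle (μ ∗ κ) (ν ∗ ρ) (R + R') := by
  refine (h.conv_right (κ := κ)).trans ?_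
  rw [Measure.conv_comm ν κ, Measure.conv_comm ν ρ]
  exact h'.conv_right

/-- Convolution powers. -/
noncomputable def cpow (μ : Measure ℝ) : ℕ → Measure ℝ
  | 0 => Measure.dirac 0
  | n + 1 => cpow μ n ∗ μ

instance cpow_prob (μ : Measure ℝ) [IsProbabilityMeasure μ] (n : ℕ) :
    IsProbabilityMeasure (cpow μ n) := by
  induction n with
  | zero => exact Measure.dirac.isProbabilityMeasure
  | succ n ih => unfold cpow; infer_instance

lemma TVle.cpow {μ ν : Measure ℝ} [IsProbabilityMeasure μ] [IsProbabilityMeasure ν] {R : ℝ}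
    (h : TVle μ ν R) (n : ℕ) : TVle (cpow μ n) (cpow ν n) (n * R) := by
  induction n with
  | zero => intro f a b c; simp [_root_.cpow]
  | succ n ih =>
    have := TVle.conv ih h
    refine TVle.mono this ?_
    push_cast; linarith

lemma charFun_cpow {μ : Measure ℝ} [IsProbabilityMeasure μ] (n : ℕ) (u : ℝ) :
    charFun (cpow μ n) u = charFun μ u ^ n := by
  induction n with
  | zero => simp [cpow, charFun_apply_real]
  | succ n ih => rw [cpow, charFun_conv, ih, pow_succ]

lemma TVle.of_sets {μ ν : Measure ℝ} [IsFiniteMeasure μ] [IsFiniteMeasure ν] {R : ℝ}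
    (h : ∀ A, MeasurableSet A → μ.real A - ν.real A ≤ R) : TVle μ ν R := fun f a b c => by
  have key : ∀ (ρ : Measure ℝ) [IsFiniteMeasure ρ], ∫ x, f x ∂ρ = ∫ t in (0 : ℝ)..1, ρ.real {x | t < f x} := by
    intro ρ _
    rw [Integrable.integral_eq_integral_meas_lt (integrable_unit a b c) (ae_of_all _ b),
      intervalIntegral.integral_of_le zero_le_one]
    refine setIntegral_eq_of_subset_of_forall_sdiff_eq_zero measurableSet_Ioi
      (fun x hx => hx.1) (fun t ht => ?_)
    have ht1 : 1 < t := by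
      by_contra hcon
      exact ht.2 ⟨ht.1, not_lt.1 hcon⟩
    have : {x | t < f x} = ∅ := by
      ext x; simp; linarith [c x]
    rw [this]; simp
  have mono : ∀ (ρ : Measure ℝ) [IsFiniteMeasure ρ],
      IntervalIntegrable (fun t => ρ.real {x | t < f x}) volume 0 1 := by
    intro ρ _
    refine AntitoneOn.intervalIntegrable (fun s _ t _ hst => ?_)
    exact measureReal_mono (fun x (hx : t < f x) => lt_of_le_of_lt hst hx)
  rw [key μ, key ν, ← intervalIntegral.integral_sub (mono μ) (mono ν)]
  calc _ ≤ ∫ _ in (0 : ℝ)..1, R := by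
        refine intervalIntegral.integral_mono_on zero_le_one ((mono μ).sub (mono ν)) (by simp)
          (fun t _ => h _ (measurableSet_lt measurable_const a))
    _ = R := by simp

lemma gaussian_eq_map (c : ℝ) (v : ℝ≥0) :
    gaussianReal c v = (gaussianReal 0 1).map (fun z => c + √(v : ℝ) * z) := by
  have h1 := gaussianReal_map_const_mul (μ := 0) (v := 1) (√(v : ℝ))
  have h2 := gaussianReal_map_const_add (μ := 0) (v := v) c
  have e : (NNReal.mk ((√(v : ℝ)) ^ 2) (sq_nonneg _) * 1 : ℝ≥0) = v := by
    ext; simp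
  rw [e, mul_zero] at h1
  rw [zero_add, ← h1, Measure.map_map (by fun_prop) (by fun_prop)] at h2
  rw [← h2]; rfl

lemma kappa_est {κ : Measure ℝ} [IsProbabilityMeasure κ] {g : ℝ → ℝ} {A B g0 w m3 : ℝ} {r : ℝ}
    (hr : 0 < r)
    (hgi : Integrable (fun y => g (y / r)) κ)
    (h1 : ∀ x, |g x - g0 - A * x| ≤ x ^ 2 / 2)
    (h2 : ∀ x, |g x - g0 - A * x - B * x ^ 2 / 2| ≤ 1.15 * |x| ^ 3 / 6)
    (i1 : Integrable (fun x => x) κ) (i2 : Integrable (fun x => x ^ 2) κ)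
    (i3 : Integrable (fun x => |x| ^ 3) κ)
    (e1 : ∫ x, x ∂κ = 0) (e2 : ∫ x, x ^ 2 ∂κ = w) (e3 : ∫ x, |x| ^ 3 ∂κ ≤ m3) :
    |∫ y, g (y / r) ∂κ - g0| ≤ w / (2 * r ^ 2) ∧
    |∫ y, g (y / r) ∂κ - g0 - B * w / (2 * r ^ 2)| ≤ 1.15 * m3 / (6 * r ^ 3) := by
  constructor
  · have : ∫ y, g (y / r) ∂κ - g0 = ∫ y, (g (y / r) - g0 - A / r * y) ∂κ := by
      rw [integral_sub (f := fun y => g (y / r) - g0) (hgi.sub (integrable_const _)) (i1.const_mul _),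
        integral_sub hgi (integrable_const _), integral_const_mul, e1]
      simp
    rw [this, ← e2, ← integral_div, ← Real.norm_eq_abs]
    refine norm_integral_le_of_norm_le (i2.div_const _) (ae_of_all _ fun y => ?_)
    rw [Real.norm_eq_abs]
    have := h1 (y / r)
    calc _ = |g (y / r) - g0 - A * (y / r)| := by congr 1; ring
      _ ≤ _ := this
      _ = _ := by field_simp
  · have : ∫ y, g (y / r) ∂κ - g0 - B * w / (2 * r ^ 2)
        = ∫ y, (g (y / r) - g0 - A / r * y - B / (2 * r ^ 2) * y ^ 2) ∂κ := by
      rw [integral_sub (f := fun y => g (y / r) - g0 - A / r * y)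
          ((hgi.sub (integrable_const _)).sub (i1.const_mul _)) (i2.const_mul _),
        integral_sub (f := fun y => g (y / r) - g0) (hgi.sub (integrable_const _)) (i1.const_mul _),
        integral_sub hgi (integrable_const _), integral_const_mul, integral_const_mul, e1, e2]
      simp; ring
    rw [this, ← Real.norm_eq_abs]
    have b : 1.15 / (6 * r ^ 3) * ∫ x, |x| ^ 3 ∂κ ≤ 1.15 * m3 / (6 * r ^ 3) := by
      rw [mul_div_right_comm]; gcongr
    refine le_trans ?_ b
    rw [← integral_const_mul]
    refine norm_integral_le_of_norm_le (i3.const_mul _) (ae_of_all _ fun y => ?_)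
    rw [Real.norm_eq_abs]
    have := h2 (y / r)
    calc _ = |g (y / r) - g0 - A * (y / r) - B * (y / r) ^ 2 / 2| := by congr 1; field_simp
      _ ≤ _ := this
      _ = _ := by rw [abs_div, abs_of_pos hr]; field_simp

lemma gauss_mom (w : ℝ≥0) : Integrable (fun x : ℝ => x) (gaussianReal 0 w) ∧
    Integrable (fun x : ℝ => x ^ 2) (gaussianReal 0 w) ∧
    Integrable (fun x : ℝ => |x| ^ 3) (gaussianReal 0 w) ∧
    ∫ x, x ∂(gaussianReal 0 w) = 0 ∧ ∫ x, x ^ 2 ∂(gaussianReal 0 w) = w ∧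
    ∫ x, |x| ^ 3 ∂(gaussianReal 0 w) ≤ 2 * √(w : ℝ) * w := by
  have i1 := (integrable_pow_gauss 1).const_mul (√(w : ℝ))
  have i2 := (integrable_pow_gauss 2).const_mul (w : ℝ)
  have i3 := (integrable_pow_gauss 3).abs.const_mul (√(w : ℝ) ^ 3)
  have hw : √(w : ℝ) ^ 2 = w := Real.sq_sqrt w.2
  have hm : AEMeasurable (fun z : ℝ => 0 + √(w : ℝ) * z) (gaussianReal 0 1) := by fun_prop
  rw [gaussian_eq_map 0 w]
  refine ⟨?_, ?_, ?_, ?_, ?_, ?_⟩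
  · rw [integrable_map_measure (by fun_prop) hm]
    simpa [Function.comp_def] using i1
  · rw [integrable_map_measure (by fun_prop) hm]
    simpa [Function.comp_def, mul_pow, hw] using i2
  · rw [integrable_map_measure (by fun_prop) hm]
    simpa [Function.comp_def, mul_pow, abs_mul, abs_of_nonneg (Real.sqrt_nonneg _)] using i3
  · rw [integral_map hm (by fun_prop)]
    simp only [zero_add]
    rw [integral_const_mul, integral_id_gaussianReal, mul_zero]
  · rw [integral_map hm (by fun_prop)]
    simp [mul_pow, hw, integral_const_mul, gauss_m2]
  · rw [integral_map hm (by fun_prop)]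
    have : ∀ x : ℝ, |0 + √(w : ℝ) * x| ^ 3 = √(w : ℝ) * w * |x| ^ 3 := fun x => by
      rw [zero_add, abs_mul, abs_of_nonneg (Real.sqrt_nonneg _), mul_pow, pow_succ, hw]; ring
    simp_rw [this]
    rw [integral_const_mul]
    have := abs_m3
    have h0 : 0 ≤ √(w : ℝ) * w := by positivity
    nlinarith

lemma lind_step {S : Measure ℝ} [IsProbabilityMeasure S] {e : ℝ} {v w : ℝ≥0} (c : ℝ) (hv : v ≠ 0)
    (hS : ∀ᵐ x ∂S, |x| ≤ e) (e1 : ∫ x, x ∂S = 0) (e2 : ∫ x, x ^ 2 ∂S = w) :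
    TVle (gaussianReal c v ∗ S) (gaussianReal c v ∗ gaussianReal 0 w)
      (min ((w : ℝ) / v) (1.15 * w * (e + 2 * √(w : ℝ)) / (6 * √(v : ℝ) ^ 3))) := by
  intro h hm h0 h1
  set r := √(v : ℝ) with hr
  have hvpos : (0 : ℝ) < v := by positivity
  have hrpos : 0 < r := Real.sqrt_pos.2 hvpos
  have hr2 : r ^ 2 = v := Real.sq_sqrt v.2
  set H : ℝ → ℝ := fun z => h (c + r * z) - 1 / 2 with hH
  have hHm : Measurable H := by fun_prop
  have hHb : ∀ z, |H z| ≤ 1 / 2 := fun z => by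
    have := h0 (c + r * z)
    have := h1 (c + r * z)
    rw [abs_le]; constructor <;> simp only [hH] <;> linarith
  obtain ⟨A, B, T1, T2⟩ := gauss_taylor hHm hHb
  set g : ℝ → ℝ := fun x => ∫ z, H (z + x) ∂(gaussianReal 0 1) with hg
  have hgm : Measurable g := by
    refine (StronglyMeasurable.integral_prod_right (f := fun x y => H (y + x)) ?_).measurable
    exact (hHm.comp (measurable_snd.add measurable_fst)).stronglyMeasurable
  have hgb : ∀ x, |g x| ≤ 1 / 2 := fun x => by
    rw [← Real.norm_eq_abs]
    refine (norm_integral_le_of_norm_le (g := fun _ => 1 / 2) (integrable_const _)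
      (ae_of_all _ fun z => hHb _)).trans (by simp)
  have hgi : ∀ (κ : Measure ℝ) [IsProbabilityMeasure κ], Integrable (fun y => g (y / r)) κ := by
    intro κ _
    exact (integrable_const (1 / 2 : ℝ)).mono'
      (hgm.comp (measurable_id.div_const r)).aestronglyMeasurable (ae_of_all _ fun y => hgb _)
  have hIntg : ∀ (κ : Measure ℝ) [IsProbabilityMeasure κ],
      ∫ x, h x ∂(gaussianReal c v ∗ κ) = ∫ y, g (y / r) ∂κ + 1 / 2 := by
    intro κ _
    rw [Measure.conv_comm, integral_conv (integrable_unit hm h0 h1)]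
    have : ∀ x, ∫ y, h (x + y) ∂(gaussianReal c v) = g (x / r) + 1 / 2 := by
      intro x
      have hmx : Measurable (fun y => h (x + y)) := by fun_prop
      rw [gaussian_eq_map c v, integral_map (by fun_prop) hmx.aestronglyMeasurable]
      simp only [hg, hH]
      rw [integral_sub _ (integrable_const _)]
      · simp
        congr 1; ext z; congr 1
        rw [← hr]; field_simp; ring
      · exact integrable_unit (by fun_prop) (fun _ => h0 _) (fun _ => h1 _)
    simp_rw [this]
    rw [integral_add (hgi κ) (integrable_const _)]
    simp
  rw [hIntg S, hIntg (gaussianReal 0 w)]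
  obtain ⟨j1, j2, j3, f1, f2, f3⟩ := gauss_mom w
  have k1 : Integrable (fun x : ℝ => x) S :=
    (integrable_const e).mono' (by fun_prop) hS
  have k2 : Integrable (fun x : ℝ => x ^ 2) S := by
    refine (integrable_const (e ^ 2)).mono' (by fun_prop) ?_
    filter_upwards [hS] with x hx
    rw [norm_pow, Real.norm_eq_abs]; gcongr
  have k3 : Integrable (fun x : ℝ => |x| ^ 3) S := by
    refine (integrable_const (e ^ 3)).mono' (by fun_prop) ?_
    filter_upwards [hS] with x hx
    rw [norm_pow, Real.norm_eq_abs, abs_abs]; gcongr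
  have k4 : ∫ x, |x| ^ 3 ∂S ≤ e * w := by
    rw [← e2, ← integral_const_mul]
    refine integral_mono_ae k3 (k2.const_mul _) ?_
    filter_upwards [hS] with x hx
    rw [pow_succ', sq_abs]; gcongr
  obtain ⟨a1, a2⟩ := kappa_est (g0 := ∫ z, H z ∂(gaussianReal 0 1)) hrpos (hgi S) T1 T2 k1 k2 k3 e1 e2 k4
  obtain ⟨c1, c2⟩ := kappa_est (g0 := ∫ z, H z ∂(gaussianReal 0 1)) hrpos (hgi (gaussianReal 0 w)) T1 T2 j1 j2 j3 f1 f2 f3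
  rw [abs_le] at a1 a2 c1 c2
  refine le_min ?_ ?_
  · have : (w : ℝ) / v = w / (2 * r ^ 2) + w / (2 * r ^ 2) := by rw [hr2]; field_simp; norm_num
    rw [this]; linarith [a1.2, c1.1]
  · have : 1.15 * w * (e + 2 * √(w : ℝ)) / (6 * r ^ 3) =
        1.15 * (e * w) / (6 * r ^ 3) + 1.15 * (2 * √(w : ℝ) * w) / (6 * r ^ 3) := by
      rw [← add_div]; ring
    rw [this]; linarith [a2.2, c2.1]

end PartThree

section PartFour

open MeasureTheory ProbabilityTheory
open scoped ENNReal NNReal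

lemma lind_sum {S : Measure ℝ} [IsProbabilityMeasure S] {e : ℝ} {v w : ℝ≥0} (c : ℝ) (hv : v ≠ 0)
    (hS : ∀ᵐ x ∂S, |x| ≤ e) (e1 : ∫ x, x ∂S = 0) (e2 : ∫ x, x ^ 2 ∂S = w) (n : ℕ) :
    TVle (gaussianReal c v ∗ cpow S n) (gaussianReal c (v + n * w))
      (∑ j ∈ Finset.range n, min ((w : ℝ) / (v + j * w : ℝ))
        (1.15 * w * (e + 2 * √(w : ℝ)) / (6 * √(v + j * w : ℝ) ^ 3))) := by
  induction n with
  | zero => intro h a b d; simp [cpow]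
  | succ n ih =>
    rw [Finset.sum_range_succ, cpow, ← Measure.conv_assoc]
    refine (ih.conv_right (κ := S)).trans ?_
    have hv' : v + n * w ≠ 0 := by positivity
    have := lind_step c hv' hS e1 e2
    rw [gaussianReal_conv_gaussianReal, add_zero] at this
    have e : v + n * w + w = v + (n + 1 : ℕ) * w := by push_cast; ring
    rw [e] at this
    simpa using this

lemma tele_step {a b : ℝ} (ha : 0 < a) (hab : a ≤ b) :
    (b ^ 2 - a ^ 2) / b ^ 3 ≤ 2 / a - 2 / b := by
  have hb : 0 < b := ha.trans_le hab
  rw [div_sub_div _ _ ha.ne' hb.ne', div_le_div_iff₀ (by positivity) (by positivity)]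
  have : 0 ≤ b * (b - a) * (2 * b ^ 2 - a * (b + a)) := by
    apply mul_nonneg (mul_nonneg hb.le (by linarith))
    nlinarith
  nlinarith

lemma tele_sum {v w : ℝ} (hv : 0 < v) (hw : 0 ≤ w) (n : ℕ) :
    ∑ j ∈ Finset.range (n + 1), w / √(v + j * w) ^ 3 ≤
      w / √v ^ 3 + 2 / √v - 2 / √(v + n * w) := by
  induction n with
  | zero => simp
  | succ n ih =>
    rw [Finset.sum_range_succ]
    have h1 : 0 < √(v + n * w) := Real.sqrt_pos.2 (by positivity)
    have h2 : √(v + n * w) ≤ √(v + (n + 1 : ℕ) * w) := by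
      apply Real.sqrt_le_sqrt; push_cast; linarith
    have := tele_step h1 h2
    rw [Real.sq_sqrt (by positivity), Real.sq_sqrt (by positivity)] at this
    have e : v + (n + 1 : ℕ) * w - (v + n * w) = w := by push_cast; ring
    rw [e] at this
    linarith

lemma lind_bound {S : Measure ℝ} [IsProbabilityMeasure S] {e : ℝ} {v w : ℝ≥0} (c : ℝ) (hv : v ≠ 0)
    (he : 0 ≤ e)
    (hS : ∀ᵐ x ∂S, |x| ≤ e) (e1 : ∫ x, x ∂S = 0) (e2 : ∫ x, x ^ 2 ∂S = w) (n : ℕ) :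
    TVle (gaussianReal c v ∗ cpow S n) (gaussianReal c (v + n * w))
      (min ((n * w : ℝ) / v) (1.15 * (e + 2 * √(w : ℝ)) / 6 * (w / √(v : ℝ) ^ 3 + 2 / √(v : ℝ)))) := by
  have hvpos : (0 : ℝ) < v := by positivity
  refine (lind_sum c hv hS e1 e2 n).mono (le_min ?_ ?_)
  · calc _ ≤ ∑ j ∈ Finset.range n, (w : ℝ) / v := by
          refine Finset.sum_le_sum fun j _ => (min_le_left _ _).trans ?_
          have : (0 : ℝ) ≤ j * w := by positivity
          gcongr; linarith
      _ = _ := by simp; ring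
  · have t := tele_sum hvpos w.coe_nonneg n
    calc _ ≤ ∑ j ∈ Finset.range (n + 1), 1.15 * (e + 2 * √(w : ℝ)) / 6 * ((w : ℝ) / √(v + j * w : ℝ) ^ 3) := by
          rw [Finset.sum_range_succ]
          refine le_add_of_le_of_nonneg (Finset.sum_le_sum fun j _ => (min_le_right _ _).trans ?_) ?_
          · apply le_of_eq; ring
          · positivity
      _ ≤ _ := by
          rw [← Finset.mul_sum]
          gcongr
          have : (0:ℝ) ≤ 2 / √(v + n * w : ℝ) := by positivity
          linarith

lemma gauss_trans_aux {v : ℝ≥0} (hv : v ≠ 0) {a b : ℝ} (hab : a ≤ b) :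
    TVle (gaussianReal b v) (gaussianReal a v) ((b - a) / (√(2 * Real.pi) * √(v : ℝ))) := by
  intro h hm h0 h1
  have hvpos : (0 : ℝ) < v := by positivity
  rw [integral_gaussianReal_eq_integral_smul hv, integral_gaussianReal_eq_integral_smul hv]
  have ii : ∀ m, Integrable (fun x => gaussianPDFReal m v x • h x) := fun m =>
    (integrable_gaussianPDFReal m v).mono' (by fun_prop) (ae_of_all _ fun x => by
      rw [smul_eq_mul, norm_mul, Real.norm_eq_abs, Real.norm_eq_abs, abs_of_nonneg (h0 x),
        abs_of_nonneg (gaussianPDFReal_nonneg _ _ _)]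
      exact mul_le_of_le_one_right (gaussianPDFReal_nonneg _ _ _) (h1 x))
  rw [← integral_sub (ii b) (ii a)]
  set m := (a + b) / 2 with hmid
  set C := (√(2 * Real.pi * v))⁻¹ with hC
  have id : ∀ (c d : ℝ), Integrable (gaussianPDFReal c v) := fun c d => integrable_gaussianPDFReal c v
  have step1 : ∫ x, (gaussianPDFReal b v x • h x - gaussianPDFReal a v x • h x) ≤
      ∫ x in Set.Ioi m, (gaussianPDFReal b v x - gaussianPDFReal a v x) := by
    rw [← integral_indicator measurableSet_Ioi]
    refine integral_mono ((ii b).sub (ii a))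
      (((integrable_gaussianPDFReal b v).sub (integrable_gaussianPDFReal a v)).indicator measurableSet_Ioi)
      (fun x => ?_)
    simp only [smul_eq_mul]
    rw [← sub_mul]
    have hCp : 0 ≤ C := by positivity
    by_cases hx : x ∈ Set.Ioi m
    · rw [Set.indicator_of_mem hx]
      refine mul_le_of_le_one_right ?_ (h1 x)
      rw [sub_nonneg, gaussianPDFReal_def, gaussianPDFReal_def]
      simp only
      have : m < x := hx
      gcongr ?_ * Real.exp ?_
      gcongr ?_ / _
      nlinarith
    · rw [Set.indicator_of_notMem hx]
      refine mul_nonpos_of_nonpos_of_nonneg ?_ (h0 x)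
      rw [sub_nonpos, gaussianPDFReal_def, gaussianPDFReal_def]
      simp only
      have : x ≤ m := not_lt.1 hx
      gcongr ?_ * Real.exp ?_
      gcongr ?_ / _
      nlinarith
  refine step1.trans ?_
  rw [integral_sub (integrable_gaussianPDFReal b v).integrableOn (integrable_gaussianPDFReal a v).integrableOn]
  have sh : ∀ d, ∫ x in Set.Ioi m, gaussianPDFReal d v x = ∫ x in Set.Ioi (m - d), gaussianPDFReal 0 v x := by
    intro d
    rw [← integral_indicator measurableSet_Ioi, ← integral_indicator measurableSet_Ioi,
      ← integral_add_right_eq_self _ d]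
    congr 1; ext x
    simp only [Set.indicator, Set.mem_Ioi, gaussianPDFReal_def, sub_zero, add_sub_cancel_right, sub_lt_iff_lt_add]
  rw [sh a, sh b]
  have := intervalIntegral.integral_Ioi_sub_Ioi (f := gaussianPDFReal 0 v) (a := m - b) (b := m - a) (μ := volume)
    (integrable_gaussianPDFReal 0 v).integrableOn (by linarith)
  rw [this]
  have hle : ∀ x, gaussianPDFReal 0 v x ≤ C := by
    intro x
    rw [gaussianPDFReal_def]
    refine mul_le_of_le_one_right (by positivity) (Real.exp_le_one_iff.2 ?_)
    apply div_nonpos_of_nonpos_of_nonneg <;> [nlinarith [sq_nonneg (x - 0)]; positivity]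
  calc _ ≤ ∫ x in (m - b)..(m - a), C := by
        refine intervalIntegral.integral_mono (by linarith)
          (integrable_gaussianPDFReal 0 v).intervalIntegrable (by simp) hle
    _ = _ := by
        simp only [intervalIntegral.integral_const, smul_eq_mul, hC]
        rw [Real.sqrt_mul (by positivity)]
        field_simp; ring

lemma gauss_trans {v : ℝ≥0} (hv : v ≠ 0) (a b : ℝ) :
    TVle (gaussianReal a v) (gaussianReal b v) (|a - b| / (√(2 * Real.pi) * √(v : ℝ))) := by
  rcases le_total a b with h | h
  · rw [abs_sub_comm, abs_of_nonneg (by linarith)]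
    exact (gauss_trans_aux hv h).symm
  · rw [abs_of_nonneg (by linarith)]
    exact gauss_trans_aux hv h

lemma gauss_var {v w : ℝ≥0} (hv : v ≠ 0) (hvw : v ≤ w) (c : ℝ) :
    TVle (gaussianReal c v) (gaussianReal c w) ((√(w : ℝ) - √(v : ℝ)) / √(w : ℝ)) := by
  have hvpos : (0 : ℝ) < v := by positivity
  have hvw' : (v : ℝ) ≤ w := by exact_mod_cast hvw
  have hwpos : (0 : ℝ) < w := by linarith
  have hw : w ≠ 0 := fun h => by simp [h] at hwpos
  set q := √(v : ℝ) / √(w : ℝ) with hq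
  have hq0 : 0 < q := by positivity
  have hq1 : q ≤ 1 := by rw [hq, div_le_one (by positivity)]; exact Real.sqrt_le_sqrt hvw'
  have eq : (√(w : ℝ) - √(v : ℝ)) / √(w : ℝ) = 1 - q := by rw [hq]; field_simp
  rw [eq]
  intro h hm h0 h1
  have dom : ∀ x, q * gaussianPDFReal c v x ≤ gaussianPDFReal c w x := by
    intro x
    simp only [gaussianPDFReal_def]
    have : q * ((√(2 * Real.pi * v))⁻¹ * Real.exp (-(x - c) ^ 2 / (2 * v))) =
      (√(2 * Real.pi * w))⁻¹ * Real.exp (-(x - c) ^ 2 / (2 * v)) := by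
      rw [hq, Real.sqrt_mul (by positivity) (v : ℝ), Real.sqrt_mul (by positivity) (w : ℝ)]
      field_simp
    rw [this]
    gcongr ?_ * Real.exp ?_
    rw [neg_div, neg_div, neg_le_neg_iff]
    gcongr
  have ii : ∀ (m : ℝ) (v : ℝ≥0), Integrable (fun x => gaussianPDFReal m v x • h x) := fun m v =>
    (integrable_gaussianPDFReal m v).mono' (by fun_prop) (ae_of_all _ fun x => by
      rw [smul_eq_mul, norm_mul, Real.norm_eq_abs, Real.norm_eq_abs, abs_of_nonneg (h0 x),
        abs_of_nonneg (gaussianPDFReal_nonneg _ _ _)]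
      exact mul_le_of_le_one_right (gaussianPDFReal_nonneg _ _ _) (h1 x))
  have k1 : q * ∫ x, h x ∂(gaussianReal c v) ≤ ∫ x, h x ∂(gaussianReal c w) := by
    rw [integral_gaussianReal_eq_integral_smul hv, integral_gaussianReal_eq_integral_smul hw,
      ← integral_const_mul]
    refine integral_mono ((ii c v).const_mul q) (ii c w) (fun x => ?_)
    simp only [smul_eq_mul]
    rw [← mul_assoc]
    exact mul_le_mul_of_nonneg_right (dom x) (h0 x)
  have k2 : ∫ x, h x ∂(gaussianReal c v) ≤ ∫ _, (1 : ℝ) ∂(gaussianReal c v) :=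
    integral_mono (integrable_unit hm h0 h1) (integrable_const _) h1
  simp at k2
  nlinarith

lemma gauss_gauss {v w : ℝ≥0} (hv : v ≠ 0) (hw : w ≠ 0) (a b : ℝ) :
    TVle (gaussianReal a v) (gaussianReal b w)
      ((|a - b| / √(2 * Real.pi) + |√(v : ℝ) - √(w : ℝ)|) / max √(v : ℝ) √(w : ℝ)) := by
  have key : ∀ {v w : ℝ≥0} (_ : v ≠ 0) (_ : w ≠ 0) (a b : ℝ), v ≤ w →
    TVle (gaussianReal a v) (gaussianReal b w)
      ((|a - b| / √(2 * Real.pi) + |√(v : ℝ) - √(w : ℝ)|) / max √(v : ℝ) √(w : ℝ)) := by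
    intro v w hv hw a b hvw
    have hs : √(v : ℝ) ≤ √(w : ℝ) := Real.sqrt_le_sqrt (by exact_mod_cast hvw)
    have hwp : 0 < √(w : ℝ) := Real.sqrt_pos.2 (by positivity)
    refine ((gauss_var hv hvw a).trans (gauss_trans hw a b)).mono ?_
    rw [max_eq_right hs, abs_sub_comm √(v : ℝ), abs_of_nonneg (sub_nonneg.2 hs)]
    apply le_of_eq
    field_simp; ring
  rcases le_total v w with h | h
  · exact key hv hw a b h
  · have := (key hw hv b a h).symm
    rwa [max_comm, abs_sub_comm, abs_sub_comm √(w : ℝ)] at this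

end PartFour

section PartFive

open MeasureTheory ProbabilityTheory Filter Topology
open scoped ENNReal NNReal

lemma sqrt_two_pi_lb : (0.77 : ℝ) < √(2 / Real.pi) := by
  apply Real.lt_sqrt_of_sq_lt
  rw [lt_div_iff₀ Real.pi_pos]
  have := Real.pi_lt_d2
  nlinarith

lemma lind_ev {v ε : ℝ} (hv : 0 < v) (hε : 0 < ε) {e w : ℕ → ℝ}
    (he : Tendsto e atTop (𝓝 ε)) (hw : Tendsto w atTop (𝓝 0)) :
    ∀ᶠ k in atTop, 1.15 * (e k + 2 * √(w k)) / 6 * (w k / √v ^ 3 + 2 / √v) ≤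
      √(2 / (Real.pi * v)) * (ε / 2) := by
  have hvp : 0 < √v := Real.sqrt_pos.2 hv
  have l : Tendsto (fun k => 1.15 * (e k + 2 * √(w k)) / 6 * (w k / √v ^ 3 + 2 / √v)) atTop
      (𝓝 (1.15 * (ε + 2 * √0) / 6 * (0 / √v ^ 3 + 2 / √v))) := by
    have hw2 : Tendsto (fun k => √(w k)) atTop (𝓝 √0) := (Real.continuous_sqrt.tendsto 0).comp hw
    exact (((he.add (hw2.const_mul 2)).const_mul 1.15).div_const 6).mul ((hw.div_const _).add_const _)
  have lt : 1.15 * (ε + 2 * √0) / 6 * (0 / √v ^ 3 + 2 / √v) < √(2 / (Real.pi * v)) * (ε / 2) := by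
    have e1 : √(2 / (Real.pi * v)) = √(2 / Real.pi) / √v := by
      rw [← Real.sqrt_div (by positivity), div_div]
    rw [e1]
    have := sqrt_two_pi_lb
    simp only [Real.sqrt_zero, mul_zero, add_zero, zero_div, zero_add]
    have e2 : 1.15 * ε / 6 * (2 / √v) = (1.15 / 3 * ε) / √v := by ring
    have e3 : √(2 / Real.pi) / √v * (ε / 2) = (√(2 / Real.pi) * ε / 2) / √v := by ring
    rw [e2, e3]
    gcongr
    nlinarith
  exact (l.eventually_lt_const lt).mono fun k hk => hk.le

lemma min_one_bd {v V : ℝ} (hv : 0 < v) (hV : 0 ≤ V) :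
    min 1 (V / v) ≤ √(2 / (Real.pi * v)) * (2 * √V) := by
  have hvp : 0 < √v := Real.sqrt_pos.2 hv
  have e1 : √(2 / (Real.pi * v)) = √(2 / Real.pi) / √v := by
    rw [← Real.sqrt_div (by positivity), div_div]
  set q := √V / √v with hq
  have hq0 : 0 ≤ q := by positivity
  have e2 : V / v = q ^ 2 := by rw [hq, div_pow, Real.sq_sqrt hV, Real.sq_sqrt hv.le]
  have e3 : √(2 / (Real.pi * v)) * (2 * √V) = √(2 / Real.pi) * (2 * q) := by rw [e1, hq]; ring
  rw [e2, e3]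
  have := sqrt_two_pi_lb
  rcases le_total q 1 with h | h
  · refine (min_le_right _ _).trans ?_
    nlinarith
  · refine (min_le_left _ _).trans ?_
    nlinarith

/-- Mixture of a point mass at `0` and the (small) jump measure `τ m`. -/
noncomputable def rho (m : Measure ℝ) (τ : ℝ) : Measure ℝ :=
  ENNReal.ofReal (1 - τ * m.real Set.univ) • Measure.dirac 0 + ENNReal.ofReal τ • m

lemma rho_prob {m : Measure ℝ} [IsFiniteMeasure m] {τ : ℝ} (h0 : 0 ≤ τ)
    (h1 : τ * m.real Set.univ ≤ 1) : IsProbabilityMeasure (rho m τ) := by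
  constructor
  simp only [rho, Measure.coe_add, Measure.coe_smul, Pi.add_apply, Pi.smul_apply, smul_eq_mul,
    measure_univ, mul_one]
  have : m Set.univ = ENNReal.ofReal (m.real Set.univ) := by
    rw [ofReal_measureReal]
  rw [this, ← ENNReal.ofReal_mul h0, ← ENNReal.ofReal_add (by linarith) (by positivity)]
  simp

lemma integrable_rho {E : Type*} [NormedAddCommGroup E]
    {m : Measure ℝ} {τ : ℝ} {f : ℝ → E} (hf : Integrable f m) :
    Integrable f (rho m τ) := by
  refine Integrable.add_measure ?_ (hf.smul_measure ENNReal.ofReal_ne_top)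
  exact (integrable_dirac (by simp)).smul_measure ENNReal.ofReal_ne_top

lemma integral_rho {E : Type*} [NormedAddCommGroup E] [NormedSpace ℝ E] [CompleteSpace E]
    {m : Measure ℝ} [IsFiniteMeasure m] {τ : ℝ} (h0 : 0 ≤ τ)
    (h1 : τ * m.real Set.univ ≤ 1) {f : ℝ → E} (hf : Integrable f m) :
    ∫ x, f x ∂(rho m τ) = (1 - τ * m.real Set.univ) • f 0 + τ • ∫ x, f x ∂m := by
  rw [rho, integral_add_measure ((integrable_dirac (by simp)).smul_measure ENNReal.ofReal_ne_top)
    (hf.smul_measure ENNReal.ofReal_ne_top), integral_smul_measure, integral_smul_measure,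
    integral_dirac, ENNReal.toReal_ofReal (by linarith), ENNReal.toReal_ofReal h0]

lemma integrable_cexp (m : Measure ℝ) [IsFiniteMeasure m] (u : ℝ) :
    Integrable (fun x : ℝ => Complex.exp ((u * x : ℝ) * Complex.I)) m :=
  (integrable_const (1 : ℝ)).mono' (by fun_prop) (ae_of_all _ fun x => by
    rw [Complex.norm_exp_ofReal_mul_I])

lemma charFun_rho {m : Measure ℝ} [IsFiniteMeasure m] {τ : ℝ} (h0 : 0 ≤ τ)
    (h1 : τ * m.real Set.univ ≤ 1) (u : ℝ) :
    charFun (rho m τ) u = 1 + τ * ∫ x : ℝ, (Complex.exp ((u * x : ℝ) * Complex.I) - 1) ∂m := by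
  rw [charFun_apply_real]
  have i := integrable_cexp m u
  have e : ∀ x : ℝ, Complex.exp (u * x * Complex.I) = Complex.exp ((u * x : ℝ) * Complex.I) := by
    intro x; push_cast; rfl
  simp_rw [e]
  rw [integral_rho h0 h1 i, integral_sub i (integrable_const _)]
  simp
  ring

lemma pow_diff_le {a b : ℂ} (ha : ‖a‖ ≤ 1) (hb : ‖b‖ ≤ 1) (n : ℕ) :
    ‖a ^ n - b ^ n‖ ≤ n * ‖a - b‖ := by
  induction n with
  | zero => simp
  | succ n ih =>
    have : a ^ (n + 1) - b ^ (n + 1) = a ^ n * (a - b) + (a ^ n - b ^ n) * b := by ring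
    rw [this]
    refine (norm_add_le _ _).trans ?_
    rw [norm_mul, norm_mul, norm_pow]
    have h1 : ‖a‖ ^ n ≤ 1 := pow_le_one₀ (norm_nonneg _) ha
    have h2 := norm_nonneg (a - b)
    have h3 := norm_nonneg (a ^ n - b ^ n)
    have h4 : ‖a‖ ^ n * ‖a - b‖ ≤ ‖a - b‖ := mul_le_of_le_one_left h2 h1
    have h5 : ‖a ^ n - b ^ n‖ * ‖b‖ ≤ ‖a ^ n - b ^ n‖ := mul_le_of_le_one_right h3 hb
    push_cast
    linarith

lemma re_expo_nonpos (m : Measure ℝ) [IsFiniteMeasure m] (u : ℝ) :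
    (∫ x : ℝ, (Complex.exp ((u * x : ℝ) * Complex.I) - 1) ∂m).re ≤ 0 := by
  have i : Integrable (fun x : ℝ => Complex.exp ((u * x : ℝ) * Complex.I) - 1) m :=
    (integrable_cexp m u).sub (integrable_const _)
  have := integral_re i
  simp only [RCLike.re_eq_complex_re] at this
  rw [← this]
  refine integral_nonpos fun x => ?_
  simp only [Complex.sub_re, Complex.one_re, Pi.zero_apply]
  have h := Complex.re_le_norm (Complex.exp ((u * x : ℝ) * Complex.I))
  rw [Complex.norm_exp_ofReal_mul_I] at h
  linarith

lemma norm_expo_le (m : Measure ℝ) [IsFiniteMeasure m] (u : ℝ) :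
    ‖∫ x : ℝ, (Complex.exp ((u * x : ℝ) * Complex.I) - 1) ∂m‖ ≤ 2 * m.real Set.univ := by
  refine norm_integral_le_of_norm_le_const (ae_of_all _ fun x => ?_)
  refine (norm_sub_le _ _).trans ?_
  rw [Complex.norm_exp_ofReal_mul_I]; norm_num

lemma rho_pow_diff {m : Measure ℝ} [IsFiniteMeasure m] {t : ℝ} (ht : 0 < t) {n : ℕ} (hn : 0 < n)
    (h1 : t / n * m.real Set.univ ≤ 1 / 2) (u : ℝ) :
    ‖charFun (rho m (t / n)) u ^ n -
      Complex.exp (t * ∫ x : ℝ, (Complex.exp ((u * x : ℝ) * Complex.I) - 1) ∂m)‖ ≤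
      4 * t ^ 2 * (m.real Set.univ ^ 2 / n) := by
  have hn' : (0 : ℝ) < n := by exact_mod_cast hn
  have h0 : 0 ≤ t / n := by positivity
  have := rho_prob h0 (m := m) (by linarith)
  set z := ∫ x : ℝ, (Complex.exp ((u * x : ℝ) * Complex.I) - 1) ∂m with hz
  have hzn := norm_expo_le m u
  have hzr := re_expo_nonpos m u
  rw [← hz] at hzn hzr
  have ha : ‖charFun (rho m (t / n)) u‖ ≤ 1 := norm_charFun_le_one u
  have hcf : charFun (rho m (t / n)) u = 1 + (t / n : ℝ) * z := charFun_rho h0 (by linarith) u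
  set w : ℂ := (t / n : ℝ) * z with hw
  have hb : ‖Complex.exp w‖ ≤ 1 := by
    rw [Complex.norm_exp, Real.exp_le_one_iff, hw, Complex.re_ofReal_mul]
    exact mul_nonpos_of_nonneg_of_nonpos h0 hzr
  have hwn : ‖w‖ ≤ t / n * (2 * m.real Set.univ) := by
    rw [hw, norm_mul, Complex.norm_real, Real.norm_eq_abs, abs_of_nonneg h0]
    gcongr
  have e : Complex.exp (t * z) = Complex.exp w ^ n := by
    rw [← Complex.exp_nat_mul, hw]
    have hnc : (n : ℂ) ≠ 0 := by exact_mod_cast hn.ne'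
    congr 1; push_cast; field_simp
  rw [e]
  refine (pow_diff_le ha hb n).trans ?_
  have hd : ‖charFun (rho m (t / n)) u - Complex.exp w‖ ≤ ‖w‖ ^ 2 := by
    rw [hcf, ← norm_neg]
    have : -(1 + w - Complex.exp w) = Complex.exp w - 1 - w := by ring
    rw [this]
    exact Complex.norm_exp_sub_one_sub_id_le (by linarith)
  calc (n : ℝ) * ‖charFun (rho m (t / n)) u - Complex.exp w‖ ≤ n * (t / n * (2 * m.real Set.univ)) ^ 2 := by
        gcongr
        exact hd.trans (by gcongr)
    _ = _ := by field_simp; ring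

lemma rho_sets {m1 m2 : Measure ℝ} [IsFiniteMeasure m1] [IsFiniteMeasure m2] {τ D : ℝ} (h0 : 0 ≤ τ)
    (h1 : τ * m1.real Set.univ ≤ 1) (h2 : τ * m2.real Set.univ ≤ 1)
    (hD : ∀ A, MeasurableSet A → |m1.real A - m2.real A| ≤ D) :
    TVle (rho m1 τ) (rho m2 τ) (τ * D) := by
  have p1 := rho_prob h0 h1
  have p2 := rho_prob h0 h2
  have key : ∀ (m : Measure ℝ) [IsFiniteMeasure m], τ * m.real Set.univ ≤ 1 → ∀ A, (0 : ℝ) ∉ A → 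
      MeasurableSet A → (rho m τ).real A = τ * m.real A := by
    intro m _ _ A hA hAm
    simp [rho, Measure.real, hA, hAm, ENNReal.toReal_ofReal h0]
  refine TVle.of_sets fun A hA => ?_
  by_cases h : (0 : ℝ) ∈ A
  · have e1 := key m1 h1 Aᶜ (by simpa) hA.compl
    have e2 := key m2 h2 Aᶜ (by simpa) hA.compl
    rw [probReal_compl_eq_one_sub hA] at e1 e2
    have := (abs_le.1 (hD Aᶜ hA.compl)).1
    nlinarith
  · rw [key m1 h1 A h hA, key m2 h2 A h hA]
    have := (abs_le.1 (hD A hA)).2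
    nlinarith

end PartFive

section PartSix

open MeasureTheory ProbabilityTheory Filter Topology
open scoped ENNReal NNReal

lemma levy_integrable {ν : Measure ℝ} (hν : ∫⁻ x, ENNReal.ofReal (min (x ^ 2) 1) ∂ν ≠ ⊤) :
    Integrable (fun x : ℝ => min (x ^ 2) 1) ν := by
  refine (lintegral_ofReal_ne_top_iff_integrable (by fun_prop) (ae_of_all _ fun x => ?_)).1 hν
  simp only [Pi.zero_apply]; positivity

lemma levy_mass {ν : Measure ℝ} (hν : ∫⁻ x, ENNReal.ofReal (min (x ^ 2) 1) ∂ν ≠ ⊤)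
    {a : ℝ} (ha : 0 < a) (ha1 : a ≤ 1) :
    ν {x : ℝ | a < |x|} ≤ ENNReal.ofReal ((∫ x, min (x ^ 2) 1 ∂ν) / a ^ 2) := by
  have hi := levy_integrable hν
  have hK : ∫⁻ x, ENNReal.ofReal (min (x ^ 2) 1) ∂ν = ENNReal.ofReal (∫ x, min (x ^ 2) 1 ∂ν) := by
    rw [ofReal_integral_eq_lintegral_ofReal hi (ae_of_all _ fun x => by simp only [Pi.zero_apply]; positivity)]
  have h1 : ν {x : ℝ | a < |x|} ≤ ν {x : ℝ | ENNReal.ofReal (a ^ 2) ≤ ENNReal.ofReal (min (x ^ 2) 1)} := by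
    refine measure_mono fun x (hx : a < |x|) => ?_
    refine ENNReal.ofReal_le_ofReal (le_min ?_ (by nlinarith))
    rw [← sq_abs x]; gcongr
  refine h1.trans ?_
  have h2 := mul_meas_ge_le_lintegral₀ (μ := ν) (f := fun x => ENNReal.ofReal (min (x ^ 2) 1))
    (by fun_prop) (ENNReal.ofReal (a ^ 2))
  rw [hK] at h2
  rw [ENNReal.ofReal_div_of_pos (by positivity), ENNReal.le_div_iff_mul_le (by left; simp; positivity) (by left; simp), mul_comm]
  exact h2

lemma norm_lk_le (u x : ℝ) : ‖lkIntegrand u x‖ ≤ (3 * u ^ 2 + 2) * min (x ^ 2) 1 := by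
  unfold lkIntegrand
  have hn : ∀ y : ℝ, ‖Complex.exp ((y : ℝ) * Complex.I)‖ = 1 := fun y => Complex.norm_exp_ofReal_mul_I y
  split_ifs with h
  · have hx2 : x ^ 2 ≤ 1 := by rw [← sq_abs]; nlinarith [abs_nonneg x]
    rw [min_eq_left hx2]
    have hw : ‖((u * x : ℝ) : ℂ) * Complex.I‖ = |u * x| := by
      rw [norm_mul, Complex.norm_I, mul_one, Complex.norm_real, Real.norm_eq_abs]
    have key : ‖Complex.exp ((u * x : ℝ) * Complex.I) - 1 - ((u * x : ℝ) : ℂ) * Complex.I‖ ≤ 3 * (u * x) ^ 2 := by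
      rcases le_total |u * x| 1 with h1 | h1
      · refine (Complex.norm_exp_sub_one_sub_id_le (by rw [hw]; exact h1)).trans ?_
        rw [hw, sq_abs]; nlinarith [sq_nonneg (u * x)]
      · refine (norm_sub_le _ _).trans ?_
        have := norm_sub_le (Complex.exp ((u * x : ℝ) * Complex.I)) 1
        rw [hn, norm_one] at this
        rw [hw, ← sq_abs]
        nlinarith
    refine key.trans ?_
    nlinarith [sq_nonneg x]
  · have hx2 : 1 ≤ x ^ 2 := by rw [← sq_abs]; nlinarith [abs_nonneg x]
    rw [min_eq_right hx2, sub_zero]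
    refine (norm_sub_le _ _).trans ?_
    rw [hn, norm_one]
    nlinarith [sq_nonneg u]

lemma measurable_lk (u : ℝ) : Measurable (lkIntegrand u) := by
  unfold lkIntegrand
  refine Measurable.sub (by fun_prop) (Measurable.ite ?_ (by fun_prop) (by fun_prop))
  exact measurableSet_le (by fun_prop) (by fun_prop)

lemma integrable_lk {ν : Measure ℝ} (hν : ∫⁻ x, ENNReal.ofReal (min (x ^ 2) 1) ∂ν ≠ ⊤) (u : ℝ) :
    Integrable (lkIntegrand u) ν :=
  ((levy_integrable hν).const_mul (3 * u ^ 2 + 2)).mono' (measurable_lk u).aestronglyMeasurable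
    (ae_of_all _ (norm_lk_le u))

/-- The annulus of small jumps. -/
def annu (ε : ℝ) (k : ℕ) : Set ℝ := {x | ε / (k + 1) < |x| ∧ |x| ≤ ε}

lemma annu_meas (ε : ℝ) (k : ℕ) : MeasurableSet (annu ε k) := by
  have h1 : MeasurableSet {x : ℝ | ε / (k + 1) < |x|} := measurableSet_lt (by fun_prop) (by fun_prop)
  have h2 : MeasurableSet {x : ℝ | |x| ≤ ε} := measurableSet_le (by fun_prop) (by fun_prop)
  exact h1.inter h2

lemma tendsto_annu {E : Type*} [NormedAddCommGroup E] [NormedSpace ℝ E]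
    {ν : Measure ℝ} {ε : ℝ} (hε : 0 < ε) {f : ℝ → E} (hf : IntegrableOn f {x : ℝ | |x| ≤ ε} ν)
    (f0 : f 0 = 0) :
    Tendsto (fun k => ∫ x in annu ε k, f x ∂ν) atTop (𝓝 (∫ x in {x : ℝ | |x| ≤ ε}, f x ∂ν)) := by
  have hU : (⋃ k, annu ε k) ⊆ {x : ℝ | |x| ≤ ε} := by
    intro x hx
    obtain ⟨k, hk⟩ := Set.mem_iUnion.1 hx
    exact hk.2
  have e : ∫ x in {x : ℝ | |x| ≤ ε}, f x ∂ν = ∫ x in ⋃ k, annu ε k, f x ∂ν := by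
    refine setIntegral_eq_of_subset_of_forall_sdiff_eq_zero
      (measurableSet_le (by fun_prop) (by fun_prop)) hU fun x hx => ?_
    have : x = 0 := by
      by_contra hne
      have hpos : 0 < |x| := abs_pos.2 hne
      obtain ⟨k, hk⟩ := exists_nat_gt (ε / |x|)
      refine hx.2 (Set.mem_iUnion.2 ⟨k, ?_, hx.1⟩)
      rw [div_lt_iff₀ hpos] at hk
      rw [div_lt_iff₀ (by positivity)]
      nlinarith
    rw [this, f0]
  rw [e]
  refine tendsto_setIntegral_of_monotone (annu_meas ε) (fun i j hij x hx => ⟨?_, hx.2⟩) (hf.mono_set hU)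
  refine lt_of_le_of_lt ?_ hx.1
  have : (i : ℝ) ≤ j := by exact_mod_cast hij
  gcongr

/-- Centered version of `rho`. -/
noncomputable def crho (m : Measure ℝ) (τ : ℝ) : Measure ℝ :=
  (rho m τ).map (fun x => x + -(τ * ∫ y, y ∂m))

lemma crho_prop {m : Measure ℝ} [IsFiniteMeasure m] {τ ε : ℝ} (h0 : 0 ≤ τ) (hε : 0 < ε) (hε1 : ε ≤ 1)
    (h1 : τ * m.real Set.univ ≤ 1) (hm : ∀ᵐ x ∂m, |x| ≤ ε) :
    IsProbabilityMeasure (crho m τ) ∧ |∫ y, y ∂m| ≤ m.real Set.univ ∧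
    (∀ᵐ x ∂(crho m τ), |x| ≤ ε + τ * m.real Set.univ) ∧
    ∫ x, x ∂(crho m τ) = 0 ∧
    ∫ x, x ^ 2 ∂(crho m τ) = τ * ∫ x, x ^ 2 ∂m - τ ^ 2 * (∫ y, y ∂m) ^ 2 ∧
    ∀ u, charFun (crho m τ) u =
      Complex.exp (-(τ * u * ∫ y, y ∂m : ℝ) * Complex.I) * charFun (rho m τ) u := by
  have p := rho_prob h0 h1
  have i1 : Integrable (fun x : ℝ => x) m := (integrable_const ε).mono' (by fun_prop) hm
  have i2 : Integrable (fun x : ℝ => x ^ 2) m := by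
    refine (integrable_const (ε ^ 2)).mono' (by fun_prop) ?_
    filter_upwards [hm] with x hx
    rw [norm_pow, Real.norm_eq_abs]; gcongr
  set β := ∫ y, y ∂m with hβ
  have hβ1 : |β| ≤ m.real Set.univ := by
    have := norm_integral_le_of_norm_le_const (μ := m) (f := fun x : ℝ => x) (C := ε) hm
    rw [Real.norm_eq_abs] at this
    refine this.trans ?_
    have := measureReal_nonneg (μ := m) (s := Set.univ)
    nlinarith
  have hmm : Measurable (fun x : ℝ => x + -(τ * β)) := by fun_prop
  have j1 : Integrable (fun x : ℝ => x) (rho m τ) := integrable_rho i1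
  have j2 : Integrable (fun x : ℝ => x ^ 2) (rho m τ) := integrable_rho i2
  have e1 : ∫ x, x ∂(rho m τ) = τ * β := by rw [integral_rho h0 h1 i1]; simp [hβ]
  have e2 : ∫ x, x ^ 2 ∂(rho m τ) = τ * ∫ x, x ^ 2 ∂m := by rw [integral_rho h0 h1 i2]; simp
  refine ⟨?_, hβ1, ?_, ?_, ?_, ?_⟩
  · exact Measure.isProbabilityMeasure_map hmm.aemeasurable
  · rw [crho, ae_map_iff hmm.aemeasurable (measurableSet_le (by fun_prop) (by fun_prop))]
    have hr : ∀ᵐ x ∂(rho m τ), |x| ≤ ε := by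
      rw [rho, ae_add_measure_iff]
      refine ⟨?_, ?_⟩
      · refine Measure.ae_smul_measure ?_ _
        rw [ae_dirac_iff (measurableSet_le (by fun_prop) (by fun_prop))]
        simp [hε.le]
      · exact Measure.ae_smul_measure hm _
    filter_upwards [hr] with x hx
    refine (abs_add_le _ _).trans ?_
    rw [abs_neg, abs_mul, abs_of_nonneg h0]
    gcongr
  · rw [crho, integral_map hmm.aemeasurable (by fun_prop), integral_add j1 (integrable_const _), e1]
    simp
  · rw [crho, integral_map hmm.aemeasurable (by fun_prop)]
    have : ∀ x : ℝ, (x + -(τ * β)) ^ 2 = x ^ 2 + (-(2 * τ * β)) * x + τ ^ 2 * β ^ 2 := fun x => by ring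
    simp_rw [this]
    rw [integral_add (f := fun x : ℝ => x ^ 2 + (-(2 * τ * β)) * x) (j2.add (j1.const_mul _)) (integrable_const _),
      integral_add j2 (j1.const_mul _), integral_const_mul, e1, e2]
    simp; ring
  · intro u
    have e3 : ∀ x : ℝ, Complex.exp (u * ((x + -(τ * β) : ℝ) : ℂ) * Complex.I) =
        Complex.exp (-(τ * u * β : ℝ) * Complex.I) * Complex.exp (u * x * Complex.I) := fun x => by
      rw [← Complex.exp_add]
      congr 1
      push_cast; ring
    rw [crho, charFun_apply_real, integral_map hmm.aemeasurable (by fun_prop), charFun_apply_real]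
    simp_rw [e3]
    rw [integral_const_mul]

end PartSix

section PartSeven

open MeasureTheory ProbabilityTheory Filter Topology
open scoped ENNReal NNReal

lemma measSet_gt (ε : ℝ) : MeasurableSet {x : ℝ | ε < |x|} :=
  measurableSet_lt (by fun_prop) (by fun_prop)

lemma measSet_le (ε : ℝ) : MeasurableSet {x : ℝ | |x| ≤ ε} :=
  measurableSet_le (by fun_prop) (by fun_prop)

lemma big_finite {ν : Measure ℝ} (hν : ∫⁻ x, ENNReal.ofReal (min (x ^ 2) 1) ∂ν ≠ ⊤)
    {a : ℝ} (ha : 0 < a) (ha1 : a ≤ 1) {A : Set ℝ} (hA : A ⊆ {x : ℝ | a < |x|}) :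
    IsFiniteMeasure (ν.restrict A) ∧
      (ν.restrict A).real Set.univ ≤ (∫ x, min (x ^ 2) 1 ∂ν) / a ^ 2 := by
  have h := (measure_mono hA).trans (levy_mass hν ha ha1)
  have hK : 0 ≤ ∫ x, min (x ^ 2) 1 ∂ν := integral_nonneg fun x => by simp only [Pi.zero_apply]; positivity
  constructor
  · refine ⟨?_⟩
    rw [Measure.restrict_apply_univ]
    exact lt_of_le_of_lt h ENNReal.ofReal_lt_top
  · rw [Measure.real, Measure.restrict_apply_univ]
    exact ENNReal.toReal_le_of_le_ofReal (by positivity) h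

lemma small_expo {ν : Measure ℝ} {ε : ℝ} (hε1 : ε ≤ 1) (k : ℕ) [IsFiniteMeasure (ν.restrict (annu ε k))]
    (u : ℝ) :
    (∫ x : ℝ, (Complex.exp ((u * x : ℝ) * Complex.I) - 1) ∂(ν.restrict (annu ε k)))
      - ((u * ∫ y, y ∂(ν.restrict (annu ε k)) : ℝ) : ℂ) * Complex.I
    = ∫ x in annu ε k, lkIntegrand u x ∂ν := by
  have hm : ∀ᵐ x ∂(ν.restrict (annu ε k)), |x| ≤ ε := by
    filter_upwards [ae_restrict_mem (annu_meas ε k)] with x hx using hx.2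
  have i1 : Integrable (fun x : ℝ => x) (ν.restrict (annu ε k)) :=
    (integrable_const ε).mono' (by fun_prop) hm
  have i2 : Integrable (fun x : ℝ => Complex.exp ((u * x : ℝ) * Complex.I) - 1) (ν.restrict (annu ε k)) :=
    (integrable_cexp _ u).sub (integrable_const _)
  have i3 : Integrable (fun x : ℝ => ((u * x : ℝ) : ℂ) * Complex.I) (ν.restrict (annu ε k)) :=
    ((i1.const_mul u).ofReal (𝕜 := ℂ)).mul_const _
  have e : ((u * ∫ y, y ∂(ν.restrict (annu ε k)) : ℝ) : ℂ) * Complex.I =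
      ∫ x : ℝ, ((u * x : ℝ) : ℂ) * Complex.I ∂(ν.restrict (annu ε k)) := by
    rw [integral_mul_const, ← integral_const_mul]
    congr 1
    exact integral_ofReal.symm
  rw [e, ← integral_sub i2 i3]
  refine integral_congr_ae ?_
  filter_upwards [hm] with x hx
  rw [lkIntegrand, if_pos (hx.trans hε1)]

lemma big_expo {ν : Measure ℝ} (hν : ∫⁻ x, ENNReal.ofReal (min (x ^ 2) 1) ∂ν ≠ ⊤)
    {ε : ℝ} (hε : 0 < ε) (hε1 : ε ≤ 1) (u : ℝ) :
    (∫ x : ℝ, (Complex.exp ((u * x : ℝ) * Complex.I) - 1) ∂(ν.restrict {x : ℝ | ε < |x|}))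
    = (∫ x in {x : ℝ | ε < |x|}, lkIntegrand u x ∂ν)
      + ((u * ∫ x in {x : ℝ | ε < |x| ∧ |x| ≤ 1}, x ∂ν : ℝ) : ℂ) * Complex.I := by
  have hfin := (big_finite hν hε hε1 (subset_refl _)).1
  have hA : MeasurableSet {x : ℝ | ε < |x| ∧ |x| ≤ 1} := (measSet_gt ε).inter (measSet_le 1)
  have hlk : Integrable (lkIntegrand u) (ν.restrict {x : ℝ | ε < |x|}) := (integrable_lk hν u).restrict
  have i2 : Integrable (fun x : ℝ => Complex.exp ((u * x : ℝ) * Complex.I) - 1) (ν.restrict {x : ℝ | ε < |x|}) :=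
    (integrable_cexp _ u).sub (integrable_const _)
  rw [← sub_eq_iff_eq_add', ← integral_sub i2 hlk]
  have e : ∀ x, Complex.exp ((u * x : ℝ) * Complex.I) - 1 - lkIntegrand u x =
      Set.indicator {x : ℝ | |x| ≤ 1} (fun x : ℝ => ((u * x : ℝ) : ℂ) * Complex.I) x := by
    intro x
    simp only [lkIntegrand, Set.indicator, Set.mem_ofPred_eq]
    ring
  simp_rw [e]
  rw [integral_indicator (measSet_le 1), Measure.restrict_restrict (measSet_le 1), integral_mul_const,
    ← integral_const_mul]
  have e2 : {x : ℝ | |x| ≤ 1} ∩ {x : ℝ | ε < |x|} = {x : ℝ | ε < |x| ∧ |x| ≤ 1} := by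
    ext x; simp [and_comm]
  rw [e2]
  congr 1
  exact integral_ofReal

lemma tendsto_inv_succ : Tendsto (fun k : ℕ => ((k : ℝ) + 1)⁻¹) atTop (𝓝 0) :=
  tendsto_inv_atTop_zero.comp (tendsto_natCast_atTop_atTop.atTop_add tendsto_const_nhds)

lemma approx_one {ν : Measure ℝ} (hν : ∫⁻ x, ENNReal.ofReal (min (x ^ 2) 1) ∂ν ≠ ⊤)
    {t ε : ℝ} (ht : 0 < t) (hε : 0 < ε) (hε1 : ε ≤ 1) {b be σ s : ℝ}
    (hbe : be = b - ∫ x in {x : ℝ | ε < |x| ∧ |x| ≤ 1}, x ∂ν)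
    (hs : s = ∫ x in {x : ℝ | |x| ≤ ε}, x ^ 2 ∂ν)
    {V : ℝ≥0} (hV : (V : ℝ) = t * σ ^ 2)
    {N : ℕ} (hN : 0 < N) (hNC : 2 * t * ((∫ x, min (x ^ 2) 1 ∂ν) / ε ^ 2) ≤ N)
    {n : ℕ → ℕ} (hn : n = fun k => N * (k + 1) ^ 5) {M : Measure ℝ} (hM : M = ν.restrict {x : ℝ | ε < |x|}) :
    IsFiniteMeasure M ∧ (∀ k, t / n k * M.real Set.univ ≤ 1) ∧
    ∃ (S : ℕ → Measure ℝ) (w : ℕ → ℝ≥0) (e : ℕ → ℝ), (∀ k, IsProbabilityMeasure (S k)) ∧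
      (∀ k, 0 ≤ e k) ∧
      (∀ k, ∀ᵐ x ∂(S k), |x| ≤ e k) ∧ (∀ k, ∫ x, x ∂(S k) = 0) ∧ (∀ k, ∫ x, x ^ 2 ∂(S k) = w k) ∧
      Tendsto e atTop (𝓝 ε) ∧ Tendsto (fun k => (w k : ℝ)) atTop (𝓝 0) ∧
      Tendsto (fun k => (n k * w k : ℝ)) atTop (𝓝 (t * s)) ∧
      ∀ u, Tendsto (fun k => charFun ((gaussianReal (t * be) V ∗ cpow (S k) (n k)) ∗
          cpow (rho M (t / n k)) (n k)) u) atTop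
        (𝓝 (Complex.exp ((t : ℂ) * ((u * b : ℝ) * Complex.I + ((-(u ^ 2 * σ ^ 2) / 2 : ℝ) : ℂ)
          + ∫ x, lkIntegrand u x ∂ν)))) := by
  set C := (∫ x, min (x ^ 2) 1 ∂ν) / ε ^ 2 with hC
  have hK : 0 ≤ ∫ x, min (x ^ 2) 1 ∂ν := integral_nonneg fun x => by simp only [Pi.zero_apply]; positivity
  have hC0 : 0 ≤ C := by positivity
  have hN' : (0 : ℝ) < N := by exact_mod_cast hN
  have hnk : ∀ k, (n k : ℝ) = N * ((k : ℝ) + 1) ^ 5 := fun k => by rw [hn]; push_cast; rfl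
  have hnpos : ∀ k, 0 < n k := fun k => by rw [hn]; positivity
  have hnpos' : ∀ k, (0 : ℝ) < n k := fun k => by exact_mod_cast hnpos k
  have hfin : ∀ k, IsFiniteMeasure (ν.restrict (annu ε k)) ∧
      (ν.restrict (annu ε k)).real Set.univ ≤ C * ((k : ℝ) + 1) ^ 2 := by
    intro k
    have hle : ε / ((k : ℝ) + 1) ≤ 1 := by
      rw [div_le_one (by positivity)]
      have : (0 : ℝ) ≤ k := by positivity
      linarith
    have := big_finite hν (a := ε / ((k : ℝ) + 1)) (by positivity) hle (A := annu ε k) (fun x hx => hx.1)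
    refine ⟨this.1, this.2.trans (le_of_eq ?_)⟩
    rw [hC]; field_simp
  obtain ⟨hMf, hMC⟩ := big_finite hν hε hε1 (subset_refl _)
  rw [← hM, ← hC] at hMC
  rw [← hM] at hMf
  have k1 : ∀ k : ℕ, (1 : ℝ) ≤ (k : ℝ) + 1 := fun k => by
    have : (0 : ℝ) ≤ k := by positivity
    linarith
  -- mass bounds
  have mass : ∀ (k : ℕ) (L : ℝ), 0 ≤ L → L ≤ C * ((k : ℝ) + 1) ^ 2 →
      t / n k * L ≤ 1 / 2 * ((k : ℝ) + 1)⁻¹ ∧ L ^ 2 / n k ≤ C ^ 2 / N * ((k : ℝ) + 1)⁻¹ := by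
    intro k L hL0 hL
    have hk := k1 k
    rw [hnk k]
    constructor
    · calc t / (N * ((k : ℝ) + 1) ^ 5) * L ≤ t / (N * ((k : ℝ) + 1) ^ 5) * (C * ((k : ℝ) + 1) ^ 2) := by gcongr
        _ = (2 * t * C) / N * (1 / 2 * (((k : ℝ) + 1) ^ 3)⁻¹) := by field_simp
        _ ≤ 1 * (1 / 2 * ((k : ℝ) + 1)⁻¹) := by
            gcongr
            · exact (div_le_one hN').2 hNC
            · exact le_self_pow₀ hk (by norm_num)
        _ = _ := one_mul _
    · calc L ^ 2 / (N * ((k : ℝ) + 1) ^ 5) ≤ (C * ((k : ℝ) + 1) ^ 2) ^ 2 / (N * ((k : ℝ) + 1) ^ 5) := by gcongr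
        _ = _ := by field_simp
  have half : ∀ k : ℕ, 1 / 2 * ((k : ℝ) + 1)⁻¹ ≤ 1 / 2 := fun k => by
    have := inv_le_one_of_one_le₀ (k1 k)
    linarith
  have hMC' : ∀ k : ℕ, M.real Set.univ ≤ C * ((k : ℝ) + 1) ^ 2 := fun k => hMC.trans (by
    have := one_le_pow₀ (n := 2) (k1 k)
    nlinarith)
  have massM := fun k => mass k (M.real Set.univ) measureReal_nonneg (hMC' k)
  refine ⟨hMf, fun k => by linarith [(massM k).1, half k], ?_⟩
  set m : ℕ → Measure ℝ := fun k => ν.restrict (annu ε k) with hm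
  have inst : ∀ k, IsFiniteMeasure (m k) := fun k => (hfin k).1
  have massm := fun k => mass k ((m k).real Set.univ) measureReal_nonneg (hfin k).2
  have hae : ∀ k, ∀ᵐ x ∂(m k), |x| ≤ ε := fun k => by
    filter_upwards [ae_restrict_mem (annu_meas ε k)] with x hx using hx.2
  have h0 : ∀ k, 0 ≤ t / n k := fun k => by have := hnpos' k; positivity
  have CP := fun k => crho_prop (m := m k) (h0 k) hε hε1 (by linarith [(massm k).1, half k]) (hae k)
  have varnn : ∀ k, 0 ≤ ∫ x, x ^ 2 ∂(crho (m k) (t / n k)) := fun k => integral_nonneg fun x => sq_nonneg _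
  -- limits
  have limt1 : Tendsto (fun k => t / n k * (m k).real Set.univ) atTop (𝓝 0) := by
    refine squeeze_zero (fun k => mul_nonneg (h0 k) measureReal_nonneg) (fun k => (massm k).1) ?_
    simpa using tendsto_inv_succ.const_mul (1 / 2 : ℝ)
  have limt2 : Tendsto (fun k => (m k).real Set.univ ^ 2 / n k) atTop (𝓝 0) := by
    refine squeeze_zero (fun k => by have := hnpos' k; positivity) (fun k => (massm k).2) ?_
    simpa using tendsto_inv_succ.const_mul (C ^ 2 / N : ℝ)
  have limt3 : Tendsto (fun k => M.real Set.univ ^ 2 / n k) atTop (𝓝 0) := by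
    refine squeeze_zero (fun k => by have := hnpos' k; positivity) (fun k => (massM k).2) ?_
    simpa using tendsto_inv_succ.const_mul (C ^ 2 / N : ℝ)
  have lims : Tendsto (fun k => ∫ x, x ^ 2 ∂(m k)) atTop (𝓝 s) := by
    rw [hs]
    refine tendsto_annu hε (f := fun x : ℝ => x ^ 2) ?_ (by simp)
    refine ((levy_integrable hν).restrict (s := {x : ℝ | |x| ≤ ε})).mono' (by fun_prop) ?_
    filter_upwards [ae_restrict_mem (measSet_le ε)] with x hx
    have hx' : |x| ≤ ε := hx
    have : x ^ 2 ≤ 1 := by rw [← sq_abs]; nlinarith [abs_nonneg x]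
    rw [min_eq_left this, Real.norm_eq_abs, abs_of_nonneg (sq_nonneg x)]
  have limnw : Tendsto (fun k => (n k : ℝ) * ∫ x, x ^ 2 ∂(crho (m k) (t / n k))) atTop (𝓝 (t * s)) := by
    have e : ∀ k, (n k : ℝ) * ∫ x, x ^ 2 ∂(crho (m k) (t / n k)) =
        t * ∫ x, x ^ 2 ∂(m k) - t ^ 2 * ((∫ y, y ∂(m k)) ^ 2 / n k) := fun k => by
      have := (hnpos' k).ne'
      rw [(CP k).2.2.2.2.1]; field_simp
    simp_rw [e]
    have : Tendsto (fun k => (∫ y, y ∂(m k)) ^ 2 / n k) atTop (𝓝 0) := by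
      refine squeeze_zero (fun k => by have := hnpos' k; positivity) (fun k => ?_) limt2
      rw [← sq_abs]
      have := (CP k).2.1
      have := hnpos' k
      gcongr
    simpa using (lims.const_mul t).sub (this.const_mul (t ^ 2))
  have limninv : Tendsto (fun k => ((n k : ℝ))⁻¹) atTop (𝓝 0) := by
    refine squeeze_zero (fun k => by have := hnpos' k; positivity) (fun k => ?_) tendsto_inv_succ
    have hN1 : (1 : ℝ) ≤ N := by exact_mod_cast hN
    have := k1 k
    gcongr
    rw [hnk k]
    calc (k : ℝ) + 1 ≤ (k + 1) ^ 5 := le_self_pow₀ this (by norm_num)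
      _ ≤ _ := le_mul_of_one_le_left (by positivity) hN1
  refine ⟨fun k => crho (m k) (t / n k), fun k => ⟨_, varnn k⟩, fun k => ε + t / n k * (m k).real Set.univ,
    fun k => (CP k).1, fun k => add_nonneg hε.le (mul_nonneg (h0 k) measureReal_nonneg),
    fun k => (CP k).2.2.1, fun k => (CP k).2.2.2.1, fun k => rfl, ?_, ?_, ?_, ?_⟩
  · simpa using limt1.const_add ε
  · have := limnw.mul limninv
    rw [mul_zero] at this
    refine this.congr fun k => ?_
    have := (hnpos' k).ne'
    field_simp
    rfl
  · exact limnw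
  · intro u
    have P1 := fun k => (CP k).1
    have P2 : ∀ k, IsProbabilityMeasure (rho M (t / n k)) := fun k =>
      rho_prob (h0 k) (by linarith [(massM k).1, half k])
    have P3 : ∀ k, IsProbabilityMeasure (rho (m k) (t / n k)) := fun k =>
      rho_prob (h0 k) (by linarith [(massm k).1, half k])
    set zs : ℕ → ℂ := fun k => ∫ x : ℝ, (Complex.exp ((u * x : ℝ) * Complex.I) - 1) ∂(m k) with hzs
    set zb : ℂ := ∫ x : ℝ, (Complex.exp ((u * x : ℝ) * Complex.I) - 1) ∂M with hzb
    set G : ℂ := charFun (gaussianReal (t * be) V) u with hG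
    set E : ℕ → ℂ := fun k => Complex.exp (-(t * u * ∫ y, y ∂(m k) : ℝ) * Complex.I) with hE
    set a : ℕ → ℂ := fun k => charFun (rho (m k) (t / n k)) u ^ n k with ha
    set b' : ℕ → ℂ := fun k => charFun (rho M (t / n k)) u ^ n k with hb'
    have cf : ∀ k, charFun ((gaussianReal (t * be) V ∗ cpow (crho (m k) (t / n k)) (n k)) ∗
          cpow (rho M (t / n k)) (n k)) u = G * E k * a k * b' k := by
      intro k
      rw [charFun_conv, charFun_conv, charFun_cpow, charFun_cpow, (CP k).2.2.2.2.2, mul_pow,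
        ← Complex.exp_nat_mul]
      have : Complex.exp ((n k : ℂ) * (-((t / n k * u * ∫ y, y ∂(m k) : ℝ) : ℂ) * Complex.I)) = E k := by
        have hne : (n k : ℂ) ≠ 0 := by exact_mod_cast (hnpos k).ne'
        rw [hE]; congr 1; push_cast; field_simp
      rw [this]; ring
    have nG : ‖G‖ ≤ 1 := norm_charFun_le_one u
    have nE : ∀ k, ‖E k‖ ≤ 1 := fun k => by
      rw [hE]
      simp only [← Complex.ofReal_neg]
      rw [Complex.norm_exp_ofReal_mul_I]
    have na : ∀ k, ‖a k‖ ≤ 1 := fun k => by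
      rw [ha]; simp only [norm_pow]
      exact pow_le_one₀ (norm_nonneg _) (norm_charFun_le_one u)
    have nB : ‖Complex.exp (t * zb)‖ ≤ 1 := by
      rw [Complex.norm_exp, Real.exp_le_one_iff, Complex.re_ofReal_mul]
      exact mul_nonpos_of_nonneg_of_nonpos ht.le (re_expo_nonpos M u)
    have da := fun k => rho_pow_diff (m := m k) ht (hnpos k) (by linarith [(massm k).1, half k]) u
    have db := fun k => rho_pow_diff (m := M) ht (hnpos k) (by linarith [(massM k).1, half k]) u
    set T : ℕ → ℂ := fun k => G * E k * Complex.exp (t * zs k) * Complex.exp (t * zb) with hT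
    have diff : Tendsto (fun k => G * E k * a k * b' k - T k) atTop (𝓝 0) := by
      have l := (limt2.const_mul (4 * t ^ 2)).add (limt3.const_mul (4 * t ^ 2))
      rw [mul_zero, add_zero] at l
      refine squeeze_zero_norm (fun k => ?_) l
      have : G * E k * a k * b' k - T k = (G * E k) * (a k * (b' k - Complex.exp (t * zb)) +
          (a k - Complex.exp (t * zs k)) * Complex.exp (t * zb)) := by rw [hT]; ring
      rw [this, norm_mul, norm_mul]
      have q1 : ‖a k * (b' k - Complex.exp (t * zb)) +
          (a k - Complex.exp (t * zs k)) * Complex.exp (t * zb)‖ ≤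
          ‖a k - Complex.exp (t * zs k)‖ + ‖b' k - Complex.exp (t * zb)‖ := by
        refine (norm_add_le _ _).trans ?_
        rw [norm_mul, norm_mul, add_comm]
        exact add_le_add (mul_le_of_le_one_right (norm_nonneg _) nB)
          (mul_le_of_le_one_left (norm_nonneg _) (na k))
      refine (mul_le_of_le_one_left (norm_nonneg _)
        (mul_le_one₀ nG (norm_nonneg _) (nE k))).trans (q1.trans (add_le_add (da k) (db k)))
    have hTe : ∀ k, T k = Complex.exp ((t : ℂ) * ((u * b : ℝ) * Complex.I + ((-(u ^ 2 * σ ^ 2) / 2 : ℝ) : ℂ)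
          + ((∫ x in annu ε k, lkIntegrand u x ∂ν) + ∫ x in {x : ℝ | ε < |x|}, lkIntegrand u x ∂ν))) := by
      intro k
      have s1 := small_expo (ν := ν) hε1 k u
      have s2 := big_expo hν hε hε1 u
      rw [hT]
      simp only [hG, hE, charFun_gaussianReal]
      rw [← s1, eq_sub_of_add_eq s2.symm, ← Complex.exp_add, ← Complex.exp_add, ← Complex.exp_add, ← hM]
      have hVc : (V : ℂ) = t * (σ : ℂ) ^ 2 := by exact_mod_cast congrArg (fun x : ℝ => (x : ℂ)) hV
      rw [hVc, hbe]
      congr 1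
      simp only [hzs, hzb]
      push_cast; ring
    have limT : Tendsto T atTop (𝓝 (Complex.exp ((t : ℂ) * ((u * b : ℝ) * Complex.I +
        ((-(u ^ 2 * σ ^ 2) / 2 : ℝ) : ℂ) + ∫ x, lkIntegrand u x ∂ν)))) := by
      rw [funext hTe]
      refine (Complex.continuous_exp.tendsto _).comp (Tendsto.const_mul _ (Tendsto.const_add _ ?_))
      have l := (tendsto_annu hε (f := lkIntegrand u) (integrable_lk hν u).integrableOn
        (by simp [lkIntegrand])).add_const (∫ x in {x : ℝ | ε < |x|}, lkIntegrand u x ∂ν)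
      have e := integral_add_compl (measSet_le ε) (integrable_lk hν u)
      have ec : {x : ℝ | |x| ≤ ε}ᶜ = {x : ℝ | ε < |x|} := by ext x; simp
      rw [ec] at e
      rw [← e]
      exact l
    have := diff.add limT
    rw [zero_add] at this
    refine this.congr fun k => ?_
    rw [cf k]; ring

end PartSeven

section PartEight

open MeasureTheory ProbabilityTheory Filter Topology
open scoped ENNReal NNReal

lemma charFn_eq (μ : Measure ℝ) (u : ℝ) : charFn μ u = charFun μ u := by
  rw [charFn, charFun_apply_real]
  congr 1; funext x; push_cast; rfl

lemma cont_le {μ1 μ2 : Measure ℝ} [IsProbabilityMeasure μ1] [IsProbabilityMeasure μ2]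
    {P1 P2 : ℕ → Measure ℝ} (h1 : ∀ k, IsProbabilityMeasure (P1 k)) (h2 : ∀ k, IsProbabilityMeasure (P2 k))
    (c1 : ∀ u, Tendsto (fun k => charFun (P1 k) u) atTop (𝓝 (charFun μ1 u)))
    (c2 : ∀ u, Tendsto (fun k => charFun (P2 k) u) atTop (𝓝 (charFun μ2 u)))
    {R : ℕ → ℝ} {r : ℝ} (hR : Tendsto R atTop (𝓝 r)) (hT : ∀ᶠ k in atTop, TVle (P1 k) (P2 k) (R k))
    {F : Set ℝ} (hF : IsClosed F) : μ1.real F - μ2.real F ≤ r := by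
  have w : ∀ {μ : Measure ℝ} [IsProbabilityMeasure μ] {P : ℕ → Measure ℝ} (h : ∀ k, IsProbabilityMeasure (P k))
      (_ : ∀ u, Tendsto (fun k => charFun (P k) u) atTop (𝓝 (charFun μ u))) (f : BoundedContinuousFunction ℝ ℝ),
      Tendsto (fun k => ∫ x, f x ∂(P k)) atTop (𝓝 (∫ x, f x ∂μ)) := by
    intro μ _ P h c f
    have := (ProbabilityMeasure.tendsto_iff_tendsto_charFun (μ := fun k => (⟨P k, h k⟩ : ProbabilityMeasure ℝ))
      (μ₀ := ⟨μ, inferInstance⟩)).2 c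
    exact ProbabilityMeasure.tendsto_iff_forall_integral_tendsto.1 this f
  have cont : ∀ f : BoundedContinuousFunction ℝ ℝ, (∀ x, 0 ≤ f x) → (∀ x, f x ≤ 1) →
      ∫ x, f x ∂μ1 - ∫ x, f x ∂μ2 ≤ r := by
    intro f f0 f1
    refine le_of_tendsto_of_tendsto ((w h1 c1 f).sub (w h2 c2 f)) hR ?_
    filter_upwards [hT] with k hk
    exact hk f f.continuous.measurable f0 f1
  have app : ∀ (μ : Measure ℝ) [IsProbabilityMeasure μ],
      Tendsto (fun n => ∫ x, ((hF.apprSeq n x : ℝ≥0) : ℝ) ∂μ) atTop (𝓝 (μ.real F)) := by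
    intro μ _
    have h := HasOuterApproxClosed.tendsto_lintegral_apprSeq hF μ
    have := (ENNReal.tendsto_toReal (measure_ne_top μ F)).comp h
    refine this.congr fun n => ?_
    simp only [Function.comp]
    rw [integral_eq_lintegral_of_nonneg_ae (ae_of_all _ fun x => NNReal.coe_nonneg _) ?_]
    · simp
    · exact (NNReal.continuous_coe.comp (hF.apprSeq n).continuous).measurable.aestronglyMeasurable
  refine le_of_tendsto ((app μ1).sub (app μ2)) (Eventually.of_forall fun n => ?_)
  have hc : Continuous (fun x => ((hF.apprSeq n x : ℝ≥0) : ℝ)) :=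
    NNReal.continuous_coe.comp (hF.apprSeq n).continuous
  exact cont (BoundedContinuousFunction.ofNormedAddCommGroup _ hc 1 (fun x => by
    rw [Real.norm_eq_abs, abs_of_nonneg (NNReal.coe_nonneg _)]
    exact_mod_cast HasOuterApproxClosed.apprSeq_apply_le_one hF n x)) (fun x => NNReal.coe_nonneg _)
    (fun x => by exact_mod_cast HasOuterApproxClosed.apprSeq_apply_le_one hF n x)

lemma tv_le_of_closed {μ1 μ2 : Measure ℝ} [IsProbabilityMeasure μ1] [IsProbabilityMeasure μ2] {r : ℝ}
    (h : ∀ F, IsClosed F → μ1.real F - μ2.real F ≤ r) : tvDist μ1 μ2 ≤ r := by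
  have key : ∀ A, MeasurableSet A → μ1.real A - μ2.real A ≤ r := by
    intro A hA
    refine le_of_forall_pos_le_add fun d hd => ?_
    obtain ⟨F, hFA, hFc, hF⟩ := hA.exists_isClosed_lt_add (measure_ne_top μ1 A)
      (ε := ENNReal.ofReal d) (by simpa using hd)
    have h1 := h F hFc
    have h2 : μ2.real F ≤ μ2.real A := measureReal_mono hFA
    have h3 : μ1.real A ≤ μ1.real F + d := by
      rw [Measure.real, Measure.real]
      have := ENNReal.toReal_mono (by finiteness) hF.le
      rwa [ENNReal.toReal_add (by finiteness) (by finiteness), ENNReal.toReal_ofReal hd.le] at this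
    linarith
  unfold tvDist
  refine ciSup_le fun A => ?_
  have h1 := key A.1 A.2
  have h2 := key A.1ᶜ A.2.compl
  rw [probReal_compl_eq_one_sub A.2, probReal_compl_eq_one_sub A.2] at h2
  rw [abs_le]
  simp only [Measure.real] at h1 h2
  constructor <;> linarith

lemma tv_ge {α : Type*} [MeasurableSpace α] {P Q : Measure α} [IsFiniteMeasure P] [IsFiniteMeasure Q]
    {A : Set α} (hA : MeasurableSet A) : |P.real A - Q.real A| ≤ tvDist P Q := by
  unfold tvDist
  refine le_ciSup (f := fun A : {A : Set α // MeasurableSet A} => |(P A.1).toReal - (Q A.1).toReal|)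
    ⟨P.real Set.univ + Q.real Set.univ, ?_⟩ ⟨A, hA⟩
  rintro _ ⟨B, rfl⟩
  have h1 : P.real B.1 ≤ P.real Set.univ := measureReal_mono (Set.subset_univ _)
  have h2 : Q.real B.1 ≤ Q.real Set.univ := measureReal_mono (Set.subset_univ _)
  have h3 : 0 ≤ P.real B.1 := measureReal_nonneg
  have h4 : 0 ≤ Q.real B.1 := measureReal_nonneg
  change |P.real B.1 - Q.real B.1| ≤ _
  rw [abs_le]; constructor <;> linarith

lemma jump_bound {ν1 ν2 : Measure ℝ} {ε lam1 lam2 : ℝ} (h1 : ν1 {x : ℝ | ε ≤ |x|} = ENNReal.ofReal lam1)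
    (h2 : ν2 {x : ℝ | ε ≤ |x|} = ENNReal.ofReal lam2) (p1 : 0 < lam1) (p2 : 0 < lam2)
    {A : Set ℝ} (hA : MeasurableSet A) :
    |(ν1.restrict {x : ℝ | ε < |x|}).real A - (ν2.restrict {x : ℝ | ε < |x|}).real A| ≤
      |lam1 - lam2| + min lam1 lam2 *
            tvDist ((ENNReal.ofReal lam1)⁻¹ • ν1.restrict {x : ℝ | ε ≤ |x|})
                   ((ENNReal.ofReal lam2)⁻¹ • ν2.restrict {x : ℝ | ε ≤ |x|}) := by
  have aux : ∀ {ν : Measure ℝ} {lam : ℝ}, ν {x : ℝ | ε ≤ |x|} = ENNReal.ofReal lam → 0 < lam →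
      ∃ p : ℝ, 0 ≤ p ∧ p ≤ 1 ∧ (ν.restrict {x : ℝ | ε < |x|}).real A = lam * p ∧
        p = ((ENNReal.ofReal lam)⁻¹ • ν.restrict {x : ℝ | ε ≤ |x|}).real (A ∩ {x : ℝ | ε < |x|}) ∧
        IsProbabilityMeasure ((ENNReal.ofReal lam)⁻¹ • ν.restrict {x : ℝ | ε ≤ |x|}) := by
    intro ν lam h p
    have hp : IsProbabilityMeasure ((ENNReal.ofReal lam)⁻¹ • ν.restrict {x : ℝ | ε ≤ |x|}) := by
      constructor
      rw [Measure.smul_apply, Measure.restrict_apply_univ, h, smul_eq_mul]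
      exact ENNReal.inv_mul_cancel (by simpa using p) ENNReal.ofReal_ne_top
    refine ⟨_, measureReal_nonneg, measureReal_le_one, ?_, rfl, hp⟩
    have sub : A ∩ {x : ℝ | ε < |x|} ⊆ {x : ℝ | ε ≤ |x|} := by
      rintro x ⟨_, hx⟩
      have h : ε < |x| := hx
      exact h.le
    rw [Measure.real, Measure.real, Measure.smul_apply, Measure.restrict_apply hA,
      Measure.restrict_apply (hA.inter (measSet_gt ε)), Set.inter_eq_left.2 sub, smul_eq_mul,
      ENNReal.toReal_mul, ENNReal.toReal_inv, ENNReal.toReal_ofReal p.le]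
    field_simp
  obtain ⟨a, a0, a1, ea, ha, pa⟩ := aux h1 p1
  obtain ⟨b, b0, b1, eb, hb, pb⟩ := aux h2 p2
  have tv := tv_ge (P := (ENNReal.ofReal lam1)⁻¹ • ν1.restrict {x : ℝ | ε ≤ |x|})
    (Q := (ENNReal.ofReal lam2)⁻¹ • ν2.restrict {x : ℝ | ε ≤ |x|}) (hA.inter (measSet_gt ε))
  rw [← ha, ← hb] at tv
  set T := tvDist ((ENNReal.ofReal lam1)⁻¹ • ν1.restrict {x : ℝ | ε ≤ |x|})
    ((ENNReal.ofReal lam2)⁻¹ • ν2.restrict {x : ℝ | ε ≤ |x|})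
  rw [ea, eb]
  rw [abs_le] at tv
  rcases le_total lam1 lam2 with h | h
  · rw [min_eq_left h, abs_sub_comm lam1, abs_of_nonneg (by linarith : 0 ≤ lam2 - lam1), abs_le]
    constructor <;> nlinarith
  · rw [min_eq_right h, abs_of_nonneg (by linarith : 0 ≤ lam1 - lam2), abs_le]
    constructor <;> nlinarith

end PartEight

section PartNine

open MeasureTheory ProbabilityTheory Filter Topology
open scoped ENNReal NNReal

noncomputable def finR (a b v1 v2 ε x y : ℝ) : ℝ :=
  (|a - b| / √(2 * Real.pi) + |√(v1 + x) - √(v2 + y)|) / max √(v1 + x) √(v2 + y) +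
  (√(2 / (Real.pi * v1)) * min (2 * √x) (ε / 2) + √(2 / (Real.pi * v2)) * min (2 * √y) (ε / 2))

lemma lind_fin {S : Measure ℝ} [IsProbabilityMeasure S] {e ε : ℝ} {v w : ℝ≥0} (c : ℝ) (hv : (0 : ℝ) < v)
    (he : 0 ≤ e)
    (hS : ∀ᵐ x ∂S, |x| ≤ e) (e1 : ∫ x, x ∂S = 0) (e2 : ∫ x, x ^ 2 ∂S = w) (n : ℕ)
    (h : 1.15 * (e + 2 * √(w : ℝ)) / 6 * (w / √(v : ℝ) ^ 3 + 2 / √(v : ℝ)) ≤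
      √(2 / (Real.pi * v)) * (ε / 2)) :
    TVle (gaussianReal c v ∗ cpow S n) (gaussianReal c (v + n * w))
      (√(2 / (Real.pi * v)) * min (2 * √(n * w : ℝ)) (ε / 2)) := by
  have hv0 : v ≠ 0 := by rintro rfl; simp at hv
  have a := lind_bound c hv0 he hS e1 e2 n
  have b : TVle (gaussianReal c v ∗ cpow S n) (gaussianReal c (v + n * w)) 1 := TVle.one
  intro f x y z
  have a' := a f x y z
  have b' := b f x y z
  have m := min_one_bd hv (V := (n * w : ℝ)) (by positivity)
  rw [mul_min_of_nonneg _ _ (Real.sqrt_nonneg _)]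
  refine le_min (le_trans (le_min b' (a'.trans (min_le_left _ _))) m) ((a'.trans (min_le_right _ _)).trans h)

lemma finR_tendsto {a b v1 v2 : ℝ} (h1 : 0 < v1) (h2 : 0 < v2) (ε : ℝ) {x y : ℝ} (hx : 0 ≤ x) (hy : 0 ≤ y)
    {X Y : ℕ → ℝ} (tX : Tendsto X atTop (𝓝 x)) (tY : Tendsto Y atTop (𝓝 y)) :
    Tendsto (fun k => finR a b v1 v2 ε (X k) (Y k)) atTop (𝓝 (finR a b v1 v2 ε x y)) := by
  unfold finR
  have q1 : Tendsto (fun k => √(v1 + X k)) atTop (𝓝 √(v1 + x)) := (tX.const_add _).sqrt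
  have q2 : Tendsto (fun k => √(v2 + Y k)) atTop (𝓝 √(v2 + y)) := (tY.const_add _).sqrt
  have p1 : 0 < √(v1 + x) := Real.sqrt_pos.2 (by linarith)
  refine Tendsto.add (Tendsto.div ((q1.sub q2).abs.const_add _) (q1.max q2)
    (lt_of_lt_of_le p1 (le_max_left _ _)).ne') (Tendsto.add ?_ ?_)
  · exact ((tX.sqrt.const_mul _).min tendsto_const_nhds).const_mul _
  · exact ((tY.sqrt.const_mul _).min tendsto_const_nhds).const_mul _

lemma finR_le {t σ1 σ2 s1 s2 : ℝ} (ht : 0 < t) (h1 : 0 < σ1) (h2 : 0 < σ2) (hs1 : 0 ≤ s1) (hs2 : 0 ≤ s2)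
    (b1 b2 ε : ℝ) : finR (t * b1) (t * b2) (t * σ1 ^ 2) (t * σ2 ^ 2) ε (t * s1) (t * s2) ≤
    (√(t / (2 * Real.pi)) * |b1 - b2| + √2 * |√(σ1 ^ 2 + s1) - √(σ2 ^ 2 + s2)|)
          / max (√(σ1 ^ 2 + s1)) (√(σ2 ^ 2 + s2))
        + (√(2 / (Real.pi * t * σ1 ^ 2)) * min (2 * √(t * s1)) (ε / 2)
          + √(2 / (Real.pi * t * σ2 ^ 2)) * min (2 * √(t * s2)) (ε / 2)) := by
  unfold finR
  rw [← mul_assoc, ← mul_assoc, ← mul_add, ← mul_add, ← mul_sub, abs_mul, abs_of_pos ht,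
    Real.sqrt_mul ht.le, Real.sqrt_mul ht.le, ← mul_sub, abs_mul, abs_of_nonneg (Real.sqrt_nonneg t),
    ← mul_max_of_nonneg _ _ (Real.sqrt_nonneg t), Real.sqrt_div ht.le]
  have tp : 0 < √t := Real.sqrt_pos.2 ht
  have pp : 0 < √(2 * Real.pi) := Real.sqrt_pos.2 (by positivity)
  have mp : 0 < max (√(σ1 ^ 2 + s1)) (√(σ2 ^ 2 + s2)) :=
    lt_of_lt_of_le (Real.sqrt_pos.2 (by positivity)) (le_max_left _ _)
  set m := max (√(σ1 ^ 2 + s1)) (√(σ2 ^ 2 + s2))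
  set d := |√(σ1 ^ 2 + s1) - √(σ2 ^ 2 + s2)| with hd
  have d0 : 0 ≤ d := abs_nonneg _
  have e : (t * |b1 - b2| / √(2 * Real.pi) + √t * d) / (√t * m) =
      (√t / √(2 * Real.pi) * |b1 - b2| + d) / m := by
    have : t = √t * √t := (Real.mul_self_sqrt ht.le).symm
    rw [div_eq_div_iff (by positivity) (by positivity)]
    nth_rewrite 1 [this]
    ring
  rw [e]
  have r2 : 1 ≤ √2 := Real.one_le_sqrt.2 (by norm_num)
  gcongr
  nlinarith

end PartNine

open Filter Topology

/-- Main total variation bound between the marginals at time `t` of two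
Lévy processes with non-degenerate Gaussian components. -/
theorem statement18 (b1 b2 σ1 σ2 : ℝ) (hσ1 : 0 < σ1) (hσ2 : 0 < σ2)
    (ν1 ν2 : Measure ℝ) (hν10 : ν1 {0} = 0) (hν20 : ν2 {0} = 0)
    (hν1levy : ∫⁻ x, ENNReal.ofReal (min (x ^ 2) 1) ∂ν1 ≠ ⊤)
    (hν2levy : ∫⁻ x, ENNReal.ofReal (min (x ^ 2) 1) ∂ν2 ≠ ⊤)
    (t ε : ℝ) (ht : 0 < t) (hε0 : 0 < ε) (hε1 : ε ≤ 1)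
    (b1e b2e s1 s2 lam1 lam2 : ℝ)
    (hb1e : b1e = b1 - ∫ x in {x : ℝ | ε < |x| ∧ |x| ≤ 1}, x ∂ν1)
    (hb2e : b2e = b2 - ∫ x in {x : ℝ | ε < |x| ∧ |x| ≤ 1}, x ∂ν2)
    (hs1 : s1 = ∫ x in {x : ℝ | |x| ≤ ε}, x ^ 2 ∂ν1)
    (hs2 : s2 = ∫ x in {x : ℝ | |x| ≤ ε}, x ^ 2 ∂ν2)
    (hlam1 : ν1 {x : ℝ | ε ≤ |x|} = ENNReal.ofReal lam1)
    (hlam2 : ν2 {x : ℝ | ε ≤ |x|} = ENNReal.ofReal lam2)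
    (hlam1pos : 0 < lam1) (hlam2pos : 0 < lam2)
    (μt1 μt2 : Measure ℝ)
    (hμt1P : IsProbabilityMeasure μt1) (hμt2P : IsProbabilityMeasure μt2)
    (hμt1 : ∀ u : ℝ, charFn μt1 u = Complex.exp ((t : ℂ) *
      ((u * b1 : ℝ) * Complex.I + ((-(u ^ 2 * σ1 ^ 2) / 2 : ℝ) : ℂ)
        + ∫ x, lkIntegrand u x ∂ν1)))
    (hμt2 : ∀ u : ℝ, charFn μt2 u = Complex.exp ((t : ℂ) *
      ((u * b2 : ℝ) * Complex.I + ((-(u ^ 2 * σ2 ^ 2) / 2 : ℝ) : ℂ)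
        + ∫ x, lkIntegrand u x ∂ν2))) :
    tvDist μt1 μt2
      ≤ (Real.sqrt (t / (2 * Real.pi)) * |b1e - b2e|
            + Real.sqrt 2 * |Real.sqrt (σ1 ^ 2 + s1) - Real.sqrt (σ2 ^ 2 + s2)|)
          / max (Real.sqrt (σ1 ^ 2 + s1)) (Real.sqrt (σ2 ^ 2 + s2))
        + (Real.sqrt (2 / (Real.pi * t * σ1 ^ 2)) * min (2 * Real.sqrt (t * s1)) (ε / 2)
          + Real.sqrt (2 / (Real.pi * t * σ2 ^ 2)) * min (2 * Real.sqrt (t * s2)) (ε / 2))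
        + t * |lam1 - lam2|
        + t * min lam1 lam2 *
            tvDist ((ENNReal.ofReal lam1)⁻¹ • ν1.restrict {x : ℝ | ε ≤ |x|})
                   ((ENNReal.ofReal lam2)⁻¹ • ν2.restrict {x : ℝ | ε ≤ |x|}) := by
  haveI := hμt1P
  haveI := hμt2P
  obtain ⟨N, hN⟩ := exists_nat_ge (max 1 (max (2 * t * ((∫ x, min (x ^ 2) 1 ∂ν1) / ε ^ 2))
    (2 * t * ((∫ x, min (x ^ 2) 1 ∂ν2) / ε ^ 2))))
  have hN0 : 0 < N := by
    have : (1 : ℝ) ≤ N := (le_max_left _ _).trans hN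
    exact_mod_cast this
  have hNC1 := (le_max_left _ _).trans ((le_max_right _ _).trans hN)
  have hNC2 := (le_max_right _ _).trans ((le_max_right _ _).trans hN)
  obtain ⟨V1, hV1⟩ : ∃ V : ℝ≥0, (V : ℝ) = t * σ1 ^ 2 := ⟨⟨t * σ1 ^ 2, by positivity⟩, rfl⟩
  obtain ⟨V2, hV2⟩ : ∃ V : ℝ≥0, (V : ℝ) = t * σ2 ^ 2 := ⟨⟨t * σ2 ^ 2, by positivity⟩, rfl⟩
  have hV1p : (0 : ℝ) < V1 := by rw [hV1]; positivity
  have hV2p : (0 : ℝ) < V2 := by rw [hV2]; positivity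
  have hV10 : V1 ≠ 0 := by rintro rfl; simp at hV1p
  have hV20 : V2 ≠ 0 := by rintro rfl; simp at hV2p
  have hs1p : 0 ≤ s1 := by rw [hs1]; exact integral_nonneg fun x => sq_nonneg x
  have hs2p : 0 ≤ s2 := by rw [hs2]; exact integral_nonneg fun x => sq_nonneg x
  set n : ℕ → ℕ := fun k => N * (k + 1) ^ 5 with hn
  have hnp : ∀ k, (0 : ℝ) < n k := fun k => by
    have : 0 < n k := by rw [hn]; positivity
    exact_mod_cast this
  obtain ⟨F1, m1, S1, w1, e1, P1, e10, ae1, mean1, var1, te1, tw1, tn1, tc1⟩ :=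
    approx_one hν1levy ht hε0 hε1 hb1e hs1 hV1 hN0 hNC1 hn rfl
  obtain ⟨F2, m2, S2, w2, e2, P2, e20, ae2, mean2, var2, te2, tw2, tn2, tc2⟩ :=
    approx_one hν2levy ht hε0 hε1 hb2e hs2 hV2 hN0 hNC2 hn rfl
  have R1 : ∀ k, IsProbabilityMeasure (rho (ν1.restrict {x : ℝ | ε < |x|}) (t / n k)) := fun k =>
    rho_prob (div_nonneg ht.le (hnp k).le) (m1 k)
  have R2 : ∀ k, IsProbabilityMeasure (rho (ν2.restrict {x : ℝ | ε < |x|}) (t / n k)) := fun k =>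
    rho_prob (div_nonneg ht.le (hnp k).le) (m2 k)
  simp only [charFn_eq] at hμt1 hμt2
  simp only [← hμt1] at tc1
  simp only [← hμt2] at tc2
  set D := |lam1 - lam2| + min lam1 lam2 *
            tvDist ((ENNReal.ofReal lam1)⁻¹ • ν1.restrict {x : ℝ | ε ≤ |x|})
                   ((ENNReal.ofReal lam2)⁻¹ • ν2.restrict {x : ℝ | ε ≤ |x|}) with hD
  have hT : ∀ᶠ k in atTop, TVle
      ((gaussianReal (t * b1e) V1 ∗ cpow (S1 k) (n k)) ∗
          cpow (rho (ν1.restrict {x : ℝ | ε < |x|}) (t / n k)) (n k))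
      ((gaussianReal (t * b2e) V2 ∗ cpow (S2 k) (n k)) ∗
          cpow (rho (ν2.restrict {x : ℝ | ε < |x|}) (t / n k)) (n k))
      (finR (t * b1e) (t * b2e) V1 V2 ε (n k * w1 k) (n k * w2 k) + t * D) := by
    filter_upwards [lind_ev hV1p hε0 te1 tw1, lind_ev hV2p hε0 te2 tw2] with k h1 h2
    haveI := R1 k
    haveI := R2 k
    haveI := P1 k
    haveI := P2 k
    have a1 := lind_fin (t * b1e) hV1p (e10 k) (ae1 k) (mean1 k) (var1 k) (n k) h1
    have a2 := (lind_fin (t * b2e) hV2p (e20 k) (ae2 k) (mean2 k) (var2 k) (n k) h2).symm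
    have g := gauss_gauss (v := V1 + n k * w1 k) (w := V2 + n k * w2 k) (by positivity)
      (by positivity) (t * b1e) (t * b2e)
    have j := (rho_sets (div_nonneg ht.le (hnp k).le) (m1 k) (m2 k)
      (fun A hA => jump_bound hlam1 hlam2 hlam1pos hlam2pos hA)).cpow (n k)
    refine (((a1.trans g).trans a2).conv j).mono (le_of_eq ?_)
    have : (n k : ℝ) * (t / n k * D) = t * D := by field_simp [(hnp k).ne']
    rw [← hD, this, finR]
    push_cast
    ring
  have hR := ((finR_tendsto (a := t * b1e) (b := t * b2e) hV1p hV2p ε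
    (mul_nonneg ht.le hs1p) (mul_nonneg ht.le hs2p) tn1 tn2).add_const (t * D))
  have main := tv_le_of_closed fun F hF => cont_le (fun k => by
      haveI := R1 k
      haveI := P1 k
      infer_instance) (fun k => by
      haveI := R2 k
      haveI := P2 k
      infer_instance) tc1 tc2 hR hT hF
  refine main.trans ?_
  have fin := finR_le ht hσ1 hσ2 hs1p hs2p b1e b2e ε
  rw [hV1, hV2, hD]
  linarith
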